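/- Let 0 < δ < 1. There is a constant C = C(δ) > 0 such that for all X ≥ 2 and all η with 0 < η ≤ 1, ∫_ℝ |S_2(α)|⁴ K_η(α) dα ≤ C η X (log X)². -/

import Mathlib

open scoped Classical
open MeasureTheory

noncomputable section

/-- `e x = exp(2πix)` -/
def e (x : ℝ) : ℂ := Complex.exp (2 * Real.pi * Complex.I * x)

/-- The exponential sum `S_k(α)` over primes `p` with `δX ≤ p^k ≤ X`. -/
def S (k δ X α : ℝ) : ℂ :=
  ∑ p ∈ (Finset.range (⌈X⌉₊ + 1)).filter
      (fun p : ℕ => p.Prime ∧ δ * X ≤ (p : ℝ) ^ k ∧ (p : ℝ) ^ k ≤ X),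
    (Real.log p : ℂ) * e ((p : ℝ) ^ k * α)

/-- The exponential sum `U_k(α)` over naturals `n` with `δX ≤ n^k ≤ X`. -/
def U (k δ X α : ℝ) : ℂ :=
  ∑ n ∈ (Finset.range (⌈X⌉₊ + 1)).filter
      (fun n : ℕ => δ * X ≤ (n : ℝ) ^ k ∧ (n : ℝ) ^ k ≤ X),
    e ((n : ℝ) ^ k * α)

/-- The exponential integral `T_k(α)`. -/
def T (k δ X α : ℝ) : ℂ :=
  ∫ t in (δ * X) ^ (1 / k)..(X ^ (1 / k)), e (α * t ^ k)

/-- Chebyshev theta function. -/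
def theta (x : ℝ) : ℝ :=
  ∑ p ∈ (Finset.range (⌊x⌋₊ + 1)).filter Nat.Prime, Real.log p

/-- The generalized Selberg integral `𝒥_k(X,h)`. -/
def selbergJ (k X h : ℝ) : ℝ :=
  ∫ x in X..(2 * X),
    (theta ((x + h) ^ (1 / k)) - theta (x ^ (1 / k)) -
      ((x + h) ^ (1 / k) - x ^ (1 / k))) ^ 2

/-- `ψ(m,z) = 1` iff every prime factor of `m` is at least `z`. -/
def psi (m : ℕ) (z : ℝ) : ℝ :=
  if ∀ p : ℕ, p.Prime → p ∣ m → z ≤ (p : ℝ) then 1 else 0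

/-- The function `z(p)` of Harman–Kumchev. -/
def zfun (X : ℝ) (p : ℕ) : ℝ :=
  if (p : ℝ) < X ^ ((1 : ℝ) / 7) then X ^ ((5 : ℝ) / 28) * (p : ℝ) ^ (-(1 : ℝ) / 2)
  else if (p : ℝ) ≤ X ^ ((3 : ℝ) / 14) then (p : ℝ)
  else X ^ ((5 : ℝ) / 14) * (p : ℝ)⁻¹

/-- The Harman–Kumchev sieve weight `ρ(m)`. -/
def rho (X : ℝ) (m : ℕ) : ℝ :=
  psi m (X ^ ((5 : ℝ) / 42)) -
    ∑ p ∈ (Finset.range (⌈X ^ ((1 : ℝ) / 4)⌉₊ + 1)).filter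
        (fun p : ℕ => p.Prime ∧ X ^ ((5 : ℝ) / 42) ≤ (p : ℝ) ∧ (p : ℝ) < X ^ ((1 : ℝ) / 4) ∧ p ∣ m),
      psi (m / p) (zfun X p)

/-- The sieved exponential sum `S̃_2(α)`. -/
def Stilde (δ X α : ℝ) : ℂ :=
  ∑ m ∈ (Finset.range (⌈X⌉₊ + 1)).filter
      (fun m : ℕ => δ * X ≤ (m : ℝ) ^ 2 ∧ (m : ℝ) ^ 2 ≤ X),
    (rho X m : ℂ) * e ((m : ℝ) ^ 2 * α)

/-- The Fejér-type kernel `K_η(α)`. -/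
def Kf (η α : ℝ) : ℝ :=
  if α = 0 then η ^ 2 else (Real.sin (Real.pi * α * η) / (Real.pi * α)) ^ 2

/-- An upper Bonferroni inequality: the truncated alternating sum over the subsets of `H` having at
most `2 * r` elements dominates the indicator of `H = ∅`. -/
theorem indicator_empty_le_sum_powerset_neg_one_pow_card {ι : Type*} (H : Finset ι) (r : ℕ) :
    (if H = ∅ then (1 : ℝ) else 0) ≤
      ∑ s ∈ H.powerset with s.card ≤ 2 * r, (-1 : ℝ) ^ s.card := by
  rw [Finset.sum_filter,
    Finset.sum_powerset_apply_card (fun j => if j ≤ 2 * r then (-1 : ℝ) ^ j else 0)]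
  split_ifs with h
  · subst h; simp
  · obtain ⟨n, hn⟩ : ∃ n, H.card = n + 1 :=
      Nat.exists_eq_succ_of_ne_zero (by simpa using h)
    have key := congrArg (Int.cast (R := ℝ)) (Int.alternating_sum_range_choose_eq_choose
      (n := n) (m := 2 * r))
    push_cast at key
    have hEq : ∑ m ∈ Finset.range (H.card + 1), (H.card.choose m) •
        (if m ≤ 2 * r then (-1 : ℝ) ^ m else 0) =
        ∑ k ∈ Finset.range (2 * r + 1), (-1 : ℝ) ^ k * ((n + 1).choose k : ℝ) := by
      rw [hn]
      have h1 : ∀ m, ((n + 1).choose m) • (if m ≤ 2 * r then (-1 : ℝ) ^ m else 0) =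
          if m < 2 * r + 1 then (-1 : ℝ) ^ m * ((n + 1).choose m : ℝ) else 0 := by
        intro m
        by_cases hm : m ≤ 2 * r
        · simp [mul_comm]
        · simp [hm]
      simp_rw [h1]
      rw [← Finset.sum_filter, ← Finset.sum_filter_of_ne (s := Finset.range (2 * r + 1))
        (p := fun m => m < n + 1 + 1)]
      · refine Finset.sum_congr ?_ fun _ _ => rfl
        ext m
        simp only [Finset.mem_filter, Finset.mem_range]
        tauto
      · intro m _ hne
        by_contra hcon
        exact hne (by rw [Nat.choose_eq_zero_of_lt (by omega)]; simp)
    rw [hEq, key, pow_mul]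
    simp

/-- Counting the integers below `D` whose residues lie in prescribed sets modulo finitely many
primes, by the Chinese remainder theorem. -/
theorem abs_card_filter_mod_mem_sub_le (s : Finset ℕ) (hs : ∀ p ∈ s, p.Prime) (Ω : ℕ → Finset ℕ)
    (k : ℕ) (hlt : ∀ p ∈ s, ∀ x ∈ Ω p, x < p) (hcard : ∀ p ∈ s, (Ω p).card = k) (D : ℕ) :
    |(((Finset.range D).filter fun d => ∀ p ∈ s, d % p ∈ Ω p).card : ℝ) -
      D * ∏ p ∈ s, ((k : ℝ) / p)| ≤ (k : ℝ) ^ s.card := by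
  classical
  set A := (Finset.range D).filter fun d => ∀ p ∈ s, d % p ∈ Ω p with hA
  have hmaps : ∀ d ∈ A, (fun p (_ : p ∈ s) => d % p) ∈ s.pi Ω := by
    intro d hd
    rw [Finset.mem_pi]
    exact (Finset.mem_filter.1 hd).2
  have hfib := Finset.card_eq_sum_card_fiberwise (f := fun d => fun p (_ : p ∈ s) => d % p) hmaps
  set P : ℕ := ∏ p ∈ s, p with hP
  have hPpos : 0 < P := Finset.prod_pos fun p hp => (hs p hp).pos
  have hcop : (s : Set ℕ).Pairwise (Function.onFun Nat.Coprime (fun p : ℕ => p)) :=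
    fun p hp q hq hpq => (Nat.coprime_primes (hs p hp) (hs q hq)).2 hpq
  have hone : ∀ x ∈ s.pi Ω,
      |((A.filter fun d => (fun p (_ : p ∈ s) => d % p) = x).card : ℝ) - D / P| ≤ 1 := by
    intro x hx
    rw [Finset.mem_pi] at hx
    let a : ℕ → ℕ := fun p => if h : p ∈ s then x p h else 0
    obtain ⟨v, hv⟩ := Nat.chineseRemainderOfFinset a (fun p => p) s
      (fun p hp => (hs p hp).ne_zero) hcop
    have hset : (A.filter fun d => (fun p (_ : p ∈ s) => d % p) = x) =
        (Finset.range D).filter (fun d => d ≡ v [MOD P]) := by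
      ext d
      have hmod : d ≡ v [MOD P] ↔ ∀ p ∈ s, d ≡ v [MOD p] :=
        ⟨fun h p hp => h.of_dvd (Finset.dvd_prod_of_mem _ hp), fun h => by
          simp_rw [Nat.modEq_iff_dvd] at h ⊢
          rw [hP, Nat.cast_prod]
          exact Finset.prod_dvd_of_coprime
            (fun p hp q hq hpq => Nat.isCoprime_iff_coprime.2 (hcop hp hq hpq)) h⟩
      have hxa : ∀ p (hp : p ∈ s), v % p = x p hp := by
        intro p hp
        have h1 := hv p hp
        rw [Nat.ModEq, show a p = x p hp by simp [a, hp],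
          Nat.mod_eq_of_lt (hlt p hp _ (hx p hp))] at h1
        exact h1
      simp only [Finset.mem_filter, hA, hmod]
      constructor
      · rintro ⟨⟨h1, -⟩, h3⟩
        refine ⟨h1, fun p hp => ?_⟩
        rw [Nat.ModEq, hxa p hp, ← h3]
      · rintro ⟨h1, h2⟩
        have h3 : ∀ p (hp : p ∈ s), d % p = x p hp := fun p hp => Eq.trans (h2 p hp) (hxa p hp)
        refine ⟨⟨h1, fun p hp => ?_⟩, ?_⟩
        · rw [h3 p hp]; exact hx p hp
        · funext p hp; exact h3 p hp
    rw [hset, ← Nat.count_eq_card_filter_range, Nat.count_modEq_card D hPpos v]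
    have hPr : (0 : ℝ) < P := by exact_mod_cast hPpos
    have hdiv : ((D / P : ℕ) : ℝ) ≤ D / P := Nat.cast_div_le
    have hdiv2 : (D : ℝ) / P < (D / P : ℕ) + 1 := by
      rw [div_lt_iff₀ hPr]
      have := Nat.lt_mul_div_succ D hPpos
      have h' : (D : ℝ) < (P : ℝ) * ((D / P : ℕ) + 1) := by exact_mod_cast this
      linarith
    rcases eq_or_lt_of_le hdiv with heq | hlt'
    · rw [abs_le]; split_ifs <;> push_cast <;> constructor <;> linarith
    · rw [abs_le]; split_ifs <;> push_cast <;> constructor <;> linarith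
  have hpi : ((s.pi Ω).card : ℝ) = (k : ℝ) ^ s.card := by
    rw [Finset.card_pi, Finset.prod_congr rfl hcard]; simp
  have hmain : (D : ℝ) * ∏ p ∈ s, ((k : ℝ) / p) = ∑ _x ∈ s.pi Ω, (D : ℝ) / P := by
    rw [Finset.sum_const, nsmul_eq_mul, hpi, Finset.prod_div_distrib, Finset.prod_const, hP]
    push_cast; ring
  rw [hfib, hmain]
  push_cast
  rw [← Finset.sum_sub_distrib, ← hpi]
  refine (Finset.abs_sum_le_sum_abs _ _).trans ((Finset.sum_le_sum hone).trans ?_)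
  simp

theorem sum_pow_le_one_add_pow {y : ℝ} (hy : 0 ≤ y) (m : ℕ) :
    ∑ j ∈ Finset.range (m + 1), y ^ j ≤ (1 + y) ^ m := by
  induction m with
  | zero => simp
  | succ m ih =>
    rw [Finset.sum_range_succ, pow_succ (1 + y)]
    have : y ^ (m + 1) ≤ (1 + y) ^ m * y := by
      rw [pow_succ]; gcongr; linarith
    nlinarith

theorem sum_powerset_card_le_pow_le {ι : Type*} (P : Finset ι) {k : ℝ} (hk : 0 ≤ k) (m : ℕ) :
    ∑ s ∈ P.powerset with s.card ≤ m, k ^ s.card ≤ (1 + k * P.card) ^ m := by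
  have h1 : ∑ s ∈ P.powerset with s.card ≤ m, k ^ s.card =
      ∑ j ∈ Finset.range (P.card + 1), if j ≤ m then (P.card.choose j : ℝ) * k ^ j else 0 := by
    rw [Finset.sum_filter, Finset.sum_powerset_apply_card (fun j => if j ≤ m then k ^ j else 0)]
    refine Finset.sum_congr rfl fun j _ => ?_
    split_ifs <;> simp
  rw [h1, ← Finset.sum_filter]
  calc _ ≤ ∑ j ∈ Finset.range (P.card + 1) with j ≤ m, (k * P.card) ^ j := by
        refine Finset.sum_le_sum fun j _ => ?_
        rw [mul_pow, mul_comm]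
        gcongr
        exact_mod_cast Nat.choose_le_pow _ _
    _ ≤ ∑ j ∈ Finset.range (m + 1), (k * P.card) ^ j := by
        refine Finset.sum_le_sum_of_subset_of_nonneg ?_ fun j _ _ => by positivity
        intro j
        simp only [Finset.mem_filter, Finset.mem_range]
        omega
    _ ≤ _ := sum_pow_le_one_add_pow (by positivity) m

/-- Brun's pure sieve: an upper bound for the number of integers below `D` avoiding `k` residue
classes modulo each prime of `P`. -/
theorem card_filter_mod_notMem_le (P : Finset ℕ) (hP : ∀ p ∈ P, p.Prime) (Ω : ℕ → Finset ℕ)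
    (k : ℕ) (hlt : ∀ p ∈ P, ∀ x ∈ Ω p, x < p) (hcard : ∀ p ∈ P, (Ω p).card = k) (D r : ℕ) :
    (((Finset.range D).filter fun d => ∀ p ∈ P, d % p ∉ Ω p).card : ℝ) ≤
      D * (∏ p ∈ P, (1 - (k : ℝ) / p) + ((3 : ℝ) ^ (2 * r))⁻¹ * ∏ p ∈ P, (1 + 3 * ((k : ℝ) / p))) +
        (1 + (k : ℝ) * P.card) ^ (2 * r) := by
  classical
  set F := P.powerset.filter fun s => s.card ≤ 2 * r with hF
  set g : Finset ℕ → ℝ := fun s => ∏ p ∈ s, ((k : ℝ) / p) with hg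
  have hg0 : ∀ s, 0 ≤ g s := fun s => Finset.prod_nonneg fun p _ => by positivity
  have h1 : (((Finset.range D).filter fun d => ∀ p ∈ P, d % p ∉ Ω p).card : ℝ) ≤
      ∑ s ∈ F, (-1 : ℝ) ^ s.card *
        ((Finset.range D).filter fun d => ∀ p ∈ s, d % p ∈ Ω p).card := by
    have : ∀ d ∈ Finset.range D, (if ∀ p ∈ P, d % p ∉ Ω p then (1 : ℝ) else 0) ≤
        ∑ s ∈ F, if ∀ p ∈ s, d % p ∈ Ω p then (-1 : ℝ) ^ s.card else 0 := by
      intro d _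
      have h := indicator_empty_le_sum_powerset_neg_one_pow_card
        (P.filter fun p => d % p ∈ Ω p) r
      simp only [Finset.filter_eq_empty_iff] at h
      refine h.trans (le_of_eq ?_)
      rw [← Finset.sum_filter]
      refine Finset.sum_congr ?_ fun _ _ => rfl
      ext s
      simp only [Finset.mem_filter, Finset.mem_powerset, hF, Finset.subset_iff]
      grind
    have h2 := Finset.sum_le_sum this
    rw [Finset.sum_comm] at h2
    refine (le_of_eq ?_).trans (h2.trans (le_of_eq ?_))
    · rw [← Finset.sum_filter]; simp
    · refine Finset.sum_congr rfl fun s _ => ?_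
      rw [← Finset.sum_filter, Finset.sum_const, nsmul_eq_mul, mul_comm]
  have h2 : ∑ s ∈ F, (-1 : ℝ) ^ s.card *
        ((Finset.range D).filter fun d => ∀ p ∈ s, d % p ∈ Ω p).card ≤
      ∑ s ∈ F, ((D : ℝ) * ((-1 : ℝ) ^ s.card * g s) + (k : ℝ) ^ s.card) := by
    refine Finset.sum_le_sum fun s hs => ?_
    have hsP : s ⊆ P := Finset.mem_powerset.1 (Finset.mem_filter.1 hs).1
    have h := abs_le.1 (abs_card_filter_mod_mem_sub_le s (fun p hp => hP p (hsP hp)) Ω k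
      (fun p hp => hlt p (hsP hp)) (fun p hp => hcard p (hsP hp)) D)
    rcases neg_one_pow_eq_or ℝ s.card with h' | h' <;> rw [h'] <;> simp only [hg] <;> linarith
  have h3 : ∑ s ∈ F, (-1 : ℝ) ^ s.card * g s ≤
      ∏ p ∈ P, (1 - (k : ℝ) / p) + ((3 : ℝ) ^ (2 * r))⁻¹ * ∏ p ∈ P, (1 + 3 * ((k : ℝ) / p)) := by
    have hfull : ∏ p ∈ P, (1 - (k : ℝ) / p) = ∑ s ∈ P.powerset, (-1 : ℝ) ^ s.card * g s := by
      rw [Finset.prod_sub]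
      simp [hg]
    have hfull' : ∏ p ∈ P, (1 + 3 * ((k : ℝ) / p)) = ∑ s ∈ P.powerset, 3 ^ s.card * g s := by
      rw [Finset.prod_one_add]
      simp [hg, Finset.prod_mul_distrib]
    rw [hfull, hfull', Finset.mul_sum, ← Finset.sum_add_distrib, hF, Finset.sum_filter]
    refine Finset.sum_le_sum fun s _ => ?_
    have hpos : 0 ≤ ((3 : ℝ) ^ (2 * r))⁻¹ * (3 ^ s.card * g s) := by
      have := hg0 s; positivity
    split_ifs with hs
    · linarith
    · have h4 : (1 : ℝ) ≤ ((3 : ℝ) ^ (2 * r))⁻¹ * 3 ^ s.card := by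
        rw [inv_mul_eq_div, le_div_iff₀ (by positivity), one_mul]
        exact pow_le_pow_right₀ (by norm_num) (by omega)
      have h5 : g s ≤ ((3 : ℝ) ^ (2 * r))⁻¹ * (3 ^ s.card * g s) := by
        nlinarith [hg0 s]
      rcases neg_one_pow_eq_or ℝ s.card with h' | h' <;> rw [h'] <;> linarith [hg0 s]
  rw [Finset.sum_add_distrib, ← Finset.mul_sum] at h2
  have h4 := sum_powerset_card_le_pow_le P (Nat.cast_nonneg (α := ℝ) k) (2 * r)
  have h5 := mul_le_mul_of_nonneg_left h3 (Nat.cast_nonneg (α := ℝ) D)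
  linarith

theorem sum_primesBelow_two_pow_inv_le (J : ℕ) :
    ∑ p ∈ Nat.primesBelow (2 ^ (J + 1)), (1 : ℝ) / p ≤ 4 * (harmonic J : ℝ) := by
  induction J with
  | zero =>
    have : Nat.primesBelow (2 ^ (0 + 1)) = ∅ := by decide
    rw [this]; simp
  | succ j ih =>
    have hsub : Nat.primesBelow (2 ^ (j + 1)) ⊆ Nat.primesBelow (2 ^ (j + 1 + 1)) := by
      intro p hp
      rw [Nat.mem_primesBelow] at hp ⊢
      exact ⟨hp.1.trans (Nat.pow_lt_pow_right one_lt_two (Nat.lt_succ_self _)), hp.2⟩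
    rw [← Finset.sum_sdiff hsub, harmonic_succ]
    push_cast
    have hlog2 : (0 : ℝ) < Real.log 2 := Real.log_pos one_lt_two
    have hblock : ∑ p ∈ Nat.primesBelow (2 ^ (j + 1 + 1)) \ Nat.primesBelow (2 ^ (j + 1)),
        (1 : ℝ) / p ≤ 4 * ((j : ℝ) + 1)⁻¹ := by
      calc _ ≤ ∑ p ∈ Nat.primesBelow (2 ^ (j + 1 + 1)) \ Nat.primesBelow (2 ^ (j + 1)),
            Real.log p / (2 ^ (j + 1) * ((j + 1) * Real.log 2)) := by
            refine Finset.sum_le_sum fun p hp => ?_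
            rw [Finset.mem_sdiff, Nat.mem_primesBelow, Nat.mem_primesBelow] at hp
            have hp2 : (2 : ℝ) ^ (j + 1) ≤ p := by
              have : 2 ^ (j + 1) ≤ p := by
                by_contra hcon
                exact hp.2 ⟨not_le.1 hcon, hp.1.2⟩
              exact_mod_cast this
            have hlogp : ((j : ℝ) + 1) * Real.log 2 ≤ Real.log p := by
              have := Real.log_le_log (by positivity) hp2
              rw [Real.log_pow] at this
              exact_mod_cast this
            have hp0 : (0 : ℝ) < p := lt_of_lt_of_le (by positivity) hp2
            rw [div_le_div_iff₀ hp0 (by positivity), one_mul, mul_comm]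
            exact mul_le_mul hlogp hp2 (by positivity) (le_trans (by positivity) hlogp)
        _ = (∑ p ∈ Nat.primesBelow (2 ^ (j + 1 + 1)) \ Nat.primesBelow (2 ^ (j + 1)),
            Real.log p) / (2 ^ (j + 1) * ((j + 1) * Real.log 2)) := by
            rw [Finset.sum_div]
        _ ≤ (Real.log 4 * 2 ^ (j + 1 + 1)) / (2 ^ (j + 1) * ((j + 1) * Real.log 2)) := by
            gcongr
            have h1 := Chebyshev.theta_le_log4_mul_x (x := 2 ^ (j + 1 + 1)) (by positivity)
            refine le_trans ?_ h1
            have h2 := Chebyshev.theta_eq_sum_primesLE_log (2 ^ (j + 1 + 1))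
            push_cast at h2
            rw [h2]
            refine Finset.sum_le_sum_of_subset_of_nonneg ?_ fun p _ _ => Real.log_natCast_nonneg p
            intro p hp
            rw [Finset.mem_sdiff, Nat.mem_primesBelow] at hp
            rw [Nat.mem_primesLE]
            exact ⟨hp.1.1.le, hp.1.2⟩
        _ = _ := by
            rw [show (4 : ℝ) = 2 ^ 2 by norm_num, Real.log_pow]
            field_simp
            push_cast
            ring
    linarith

theorem sum_primesBelow_two_pow_inv_le_log {J : ℕ} (hJ : 1 ≤ J) :
    ∑ p ∈ Nat.primesBelow (2 ^ J), (1 : ℝ) / p ≤ 4 + 4 * Real.log J := by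
  obtain ⟨j, rfl⟩ := Nat.exists_eq_add_of_le' hJ
  have h1 := sum_primesBelow_two_pow_inv_le j
  rcases Nat.eq_zero_or_pos j with rfl | hj
  · simp
  · have h2 := harmonic_le_one_add_log j
    have h3 : Real.log j ≤ Real.log ((j + 1 : ℕ) : ℝ) :=
      Real.log_le_log (by exact_mod_cast hj) (by push_cast; linarith)
    linarith

theorem log_mul_prod_primesBelow_le_one {N : ℕ} (hN : 1 ≤ N) :
    Real.log N * ∏ p ∈ Nat.primesBelow N, (1 - (1 : ℝ) / p) ≤ 1 := by
  let f : ℕ →* ℝ :=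
    { toFun := fun n => (n : ℝ)⁻¹
      map_one' := by simp
      map_mul' := fun a b => by push_cast; rw [mul_inv] }
  have hf : ∀ n : ℕ, f n = (n : ℝ)⁻¹ := fun _ => rfl
  have hlt : ∀ {p : ℕ}, p.Prime → ‖f p‖ < 1 := by
    intro p hp
    rw [hf, Real.norm_eq_abs, abs_of_nonneg (by positivity)]
    exact inv_lt_one_of_one_lt₀ (by exact_mod_cast hp.one_lt)
  obtain ⟨-, hsum⟩ :=
    EulerProduct.summable_and_hasSum_smoothNumbers_prod_primesBelow_geometric hlt N
  have hlow : Real.log N ≤ ∏ p ∈ Nat.primesBelow N, (1 - f p)⁻¹ := by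
    obtain ⟨n, rfl⟩ := Nat.exists_eq_add_of_le' hN
    have h1 := log_add_one_le_harmonic n
    rw [harmonic_eq_sum_Icc] at h1
    push_cast at h1 ⊢
    refine h1.trans ?_
    have hmem : ∀ m ∈ Finset.Icc 1 n, m ∈ Nat.smoothNumbers (n + 1) := fun m hm =>
      Nat.mem_smoothNumbers_of_lt (Finset.mem_Icc.1 hm).1
        (Nat.lt_succ_of_le (Finset.mem_Icc.1 hm).2)
    refine le_trans (le_of_eq ?_)
      (sum_le_hasSum ((Finset.Icc 1 n).subtype (· ∈ Nat.smoothNumbers (n + 1)))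
      (fun m _ => ?_) hsum)
    · exact (Finset.sum_subtype_of_mem (fun m : ℕ => (m : ℝ)⁻¹) hmem).symm
    · rw [hf]; positivity
  have hprod : ∏ p ∈ Nat.primesBelow N, (1 - (1 : ℝ) / p) =
      (∏ p ∈ Nat.primesBelow N, (1 - f p)⁻¹)⁻¹ := by
    rw [Finset.prod_inv_distrib, inv_inv]
    exact Finset.prod_congr rfl fun p _ => by rw [hf, one_div]
  rw [hprod]
  rcases (Real.log_natCast_nonneg N).eq_or_lt with h0 | h0
  · rw [← h0]; simp
  · rw [← div_eq_mul_inv, div_le_one (h0.trans_le hlow)]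
    exact hlow

/-- The density surviving a four-dimensional sieve by the primes below `2 ^ J`, when the primes
below `2 ^ I` and the prime factors of `Δ` are left out. -/
theorem prod_one_sub_four_div_le {I J Δ : ℕ} (hI : 3 ≤ I) (hJ : 1 ≤ J) {B : ℝ}
    (hΔ : (Δ.primeFactors.card : ℝ) ≤ B * 2 ^ I) :
    ∏ p ∈ (Nat.primesBelow (2 ^ J)).filter (fun p => 2 ^ I ≤ p ∧ p ∉ Δ.primeFactors),
      (1 - (4 : ℝ) / p) ≤
      (Real.exp (8 + 8 * Real.log I + 2 * B) / (J * Real.log 2)) ^ 4 := by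
  set A := (Nat.primesBelow (2 ^ J)).filter (fun p => 2 ^ I ≤ p ∧ p ∉ Δ.primeFactors) with hA
  set E := (Nat.primesBelow (2 ^ J)).filter (fun p => ¬ (2 ^ I ≤ p ∧ p ∉ Δ.primeFactors)) with hE
  have hlog2 : (0 : ℝ) < Real.log 2 := Real.log_pos one_lt_two
  have hJ0 : (0 : ℝ) < J := by exact_mod_cast hJ
  have hhalf : ∀ p ∈ Nat.primesBelow (2 ^ J), (0 : ℝ) ≤ 1 / p ∧ (1 : ℝ) / p ≤ 1 / 2 := by
    intro p hp
    have : (2 : ℝ) ≤ p := by exact_mod_cast (Nat.prime_of_mem_primesBelow hp).two_le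
    exact ⟨by positivity, one_div_le_one_div_of_le two_pos this⟩
  have h1 : ∏ p ∈ A, (1 - (4 : ℝ) / p) ≤ (∏ p ∈ A, (1 - (1 : ℝ) / p)) ^ 4 := by
    rw [← Finset.prod_pow]
    refine Finset.prod_le_prod (fun p hp => ?_) fun p hp => ?_
    · have h8 : 2 ^ 3 ≤ p :=
        (Nat.pow_le_pow_right two_pos hI).trans (Finset.mem_filter.1 hp).2.1
      have : (8 : ℝ) ≤ p := by exact_mod_cast h8
      rw [sub_nonneg, div_le_one (by linarith)]
      linarith
    · have h := hhalf p (Finset.mem_filter.1 hp).1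
      have := one_add_mul_le_pow (a := -((1 : ℝ) / p)) (by linarith [h.2]) 4
      calc (1 - (4 : ℝ) / p) = 1 + ((4 : ℕ) : ℝ) * -((1 : ℝ) / p) := by push_cast; ring
        _ ≤ _ := this
        _ = _ := by ring
  have hsplit : (∏ p ∈ A, (1 - (1 : ℝ) / p)) * ∏ p ∈ E, (1 - (1 : ℝ) / p) =
      ∏ p ∈ Nat.primesBelow (2 ^ J), (1 - (1 : ℝ) / p) :=
    Finset.prod_filter_mul_prod_filter_not _ _ _
  have hEsum : ∑ p ∈ E, (1 : ℝ) / p ≤ 4 + 4 * Real.log I + B := by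
    have hsub : E ⊆ Nat.primesBelow (2 ^ I) ∪ Δ.primeFactors.filter (fun p => 2 ^ I ≤ p) := by
      intro p hp
      rw [hE, Finset.mem_filter, Nat.mem_primesBelow] at hp
      rw [Finset.mem_union, Nat.mem_primesBelow, Finset.mem_filter]
      rcases lt_or_ge p (2 ^ I) with h | h
      · exact Or.inl ⟨h, hp.1.2⟩
      · exact Or.inr ⟨by tauto, h⟩
    have h2 : ∑ p ∈ Δ.primeFactors.filter (fun p => 2 ^ I ≤ p), (1 : ℝ) / p ≤ B := by
      calc _ ≤ ∑ p ∈ Δ.primeFactors.filter (fun p => 2 ^ I ≤ p), (1 : ℝ) / 2 ^ I := by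
            refine Finset.sum_le_sum fun p hp => ?_
            have : (2 : ℝ) ^ I ≤ p := by exact_mod_cast (Finset.mem_filter.1 hp).2
            exact one_div_le_one_div_of_le (by positivity) this
        _ ≤ (Δ.primeFactors.card : ℝ) * (1 / 2 ^ I) := by
            rw [Finset.sum_const, nsmul_eq_mul]
            gcongr
            exact Finset.filter_subset _ _
        _ ≤ B := by
            rw [mul_one_div, div_le_iff₀ (by positivity)]
            exact hΔ
    have h3 := sum_primesBelow_two_pow_inv_le_log (by omega : 1 ≤ I)
    calc _ ≤ ∑ p ∈ Nat.primesBelow (2 ^ I) ∪ Δ.primeFactors.filter (fun p => 2 ^ I ≤ p),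
          (1 : ℝ) / p :=
          Finset.sum_le_sum_of_subset_of_nonneg hsub fun p _ _ => by positivity
      _ ≤ ∑ p ∈ Nat.primesBelow (2 ^ I), (1 : ℝ) / p +
          ∑ p ∈ Δ.primeFactors.filter (fun p => 2 ^ I ≤ p), (1 : ℝ) / p := by
          rw [← Finset.sum_union_inter]
          exact le_add_of_nonneg_right (Finset.sum_nonneg fun p _ => by positivity)
      _ ≤ _ := by linarith
  have hElow : Real.exp (-(8 + 8 * Real.log I + 2 * B)) ≤ ∏ p ∈ E, (1 - (1 : ℝ) / p) := by
    calc _ ≤ Real.exp (∑ p ∈ E, -(2 * ((1 : ℝ) / p))) := by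
          rw [Real.exp_le_exp, Finset.sum_neg_distrib, ← Finset.mul_sum]
          linarith
      _ = ∏ p ∈ E, Real.exp (-(2 * ((1 : ℝ) / p))) := Real.exp_sum _ _
      _ ≤ _ := by
          refine Finset.prod_le_prod (fun p _ => (Real.exp_pos _).le) fun p hp => ?_
          obtain ⟨hx0, hx1⟩ := hhalf p (Finset.mem_filter.1 hp).1
          set x := (1 : ℝ) / p
          rw [Real.exp_neg, inv_le_comm₀ (Real.exp_pos _) (by linarith)]
          have h4 := Real.add_one_le_exp (2 * x)
          refine le_trans ?_ h4
          rw [inv_le_iff_one_le_mul₀ (by linarith)]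
          nlinarith
  have hA0 : 0 ≤ ∏ p ∈ A, (1 - (1 : ℝ) / p) := Finset.prod_nonneg fun p hp => by
    linarith [(hhalf p (Finset.mem_filter.1 hp).1).2]
  have hfull := log_mul_prod_primesBelow_le_one (N := 2 ^ J) Nat.one_le_two_pow
  push_cast at hfull
  rw [Real.log_pow, ← hsplit] at hfull
  refine h1.trans (pow_le_pow_left₀ hA0 ?_ 4)
  rw [le_div_iff₀ (by positivity)]
  have h5 : (∏ p ∈ A, (1 - (1 : ℝ) / p)) * (J * Real.log 2) *
      Real.exp (-(8 + 8 * Real.log I + 2 * B)) ≤ 1 := by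
    refine le_trans ?_ hfull
    calc _ ≤ (∏ p ∈ A, (1 - (1 : ℝ) / p)) * (J * Real.log 2) * ∏ p ∈ E, (1 - (1 : ℝ) / p) := by
          gcongr
      _ = _ := by ring
  rw [Real.exp_neg, ← div_eq_mul_inv, div_le_one (Real.exp_pos _)] at h5
  exact h5

/-- `n` is twice a prime. -/
def IsTwicePrime (n : ℕ) : Prop := ∃ p : ℕ, p.Prime ∧ n = 2 * p

/-- The four numbers `cd ± ab` and `bd ± ac` are twice a prime in absolute value. -/
def AreTwicePrimes (a b c d : ℕ) : Prop :=
  IsTwicePrime (c * d + a * b) ∧ IsTwicePrime ((c : ℤ) * d - a * b).natAbs ∧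
    IsTwicePrime (b * d + a * c) ∧ IsTwicePrime ((b : ℤ) * d - a * c).natAbs

/-- The product of the four linear forms `cx ± ab` and `bx ± ac`. -/
def formProduct (a b c : ℕ) (x : ℤ) : ℤ :=
  (c * x + a * b) * (c * x - a * b) * ((b * x + a * c) * (b * x - a * c))

/-- The residues modulo `p` at which one of the linear forms `cx ± ab`, `bx ± ac` vanishes. -/
def formRoots (a b c p : ℕ) : Finset ℕ :=
  (Finset.range p).filter fun x => (p : ℤ) ∣ formProduct a b c x

theorem card_formRoots {a b c p : ℕ} (hp : p.Prime) (hp2 : p ≠ 2)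
    (hΔ : ¬ p ∣ a * b * c * ((b : ℤ) ^ 4 - (c : ℤ) ^ 4).natAbs) : (formRoots a b c p).card = 4 := by
  have : Fact p.Prime := ⟨hp⟩
  have hne : ((a : ZMod p) * b * c) * ((b : ZMod p) ^ 4 - (c : ZMod p) ^ 4) ≠ 0 := by
    intro h
    apply hΔ
    have h1 : ((((a * b * c : ℕ) : ℤ) * ((b : ℤ) ^ 4 - (c : ℤ) ^ 4) : ℤ) : ZMod p) = 0 := by
      push_cast; exact h
    rw [ZMod.intCast_zmod_eq_zero_iff_dvd] at h1
    have h2 := Int.natAbs_dvd_natAbs.2 h1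
    rwa [Int.natAbs_mul, Int.natAbs_natCast, Int.natAbs_natCast] at h2
  have h2 : (2 : ZMod p) ≠ 0 := by
    intro h
    have h' : ((2 : ℕ) : ZMod p) = 0 := by exact_mod_cast h
    rw [ZMod.natCast_eq_zero_iff] at h'
    exact hp2 ((Nat.prime_dvd_prime_iff_eq hp Nat.prime_two).1 h')
  obtain ⟨⟨⟨ha, hb⟩, hc⟩, hbc⟩ : (((a : ZMod p) ≠ 0 ∧ (b : ZMod p) ≠ 0) ∧ (c : ZMod p) ≠ 0) ∧
      (b : ZMod p) ^ 4 - (c : ZMod p) ^ 4 ≠ 0 := by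
    simpa only [mul_ne_zero_iff] using hne
  set u : ZMod p := a * b / c with hu
  set v : ZMod p := a * c / b with hv
  have huc : (c : ZMod p) * u = a * b := by rw [hu]; field_simp
  have hvb : (b : ZMod p) * v = a * c := by rw [hv]; field_simp
  have hu0 : u ≠ 0 := by rw [hu]; exact div_ne_zero (mul_ne_zero ha hb) hc
  have hv0 : v ≠ 0 := by rw [hv]; exact div_ne_zero (mul_ne_zero ha hc) hb
  have huv : u ^ 2 ≠ v ^ 2 := by
    intro h
    apply hbc
    have h3 : ((c : ZMod p) * u) ^ 2 * b ^ 2 = (b * v) ^ 2 * c ^ 2 := by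
      rw [mul_pow, mul_pow, h]; ring
    rw [huc, hvb] at h3
    have h4 : (a : ZMod p) ^ 2 * ((b : ZMod p) ^ 4 - (c : ZMod p) ^ 4) = 0 := by
      linear_combination h3
    exact (mul_eq_zero.1 h4).resolve_left (pow_ne_zero 2 ha)
  have hneg : ∀ x : ZMod p, x ≠ 0 → x ≠ -x := by
    intro x hx h
    have : 2 * x = 0 := by linear_combination h
    exact (mul_ne_zero h2 hx) this
  have hcard : ({u, -u, v, -v} : Finset (ZMod p)).card = 4 := by
    have h1 : u ≠ v := fun h => huv (by rw [h])
    have h3 : u ≠ -v := fun h => huv (by rw [h]; ring)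
    have h4 : -u ≠ v := fun h => huv (by rw [← h]; ring)
    have h5 : -u ≠ -v := fun h => h1 (neg_injective h)
    rw [Finset.card_insert_of_notMem, Finset.card_insert_of_notMem, Finset.card_pair (hneg v hv0)]
    · simp [h4, h5]
    · simp [h1, h3, hneg u hu0]
  have himg : formRoots a b c p = ({u, -u, v, -v} : Finset (ZMod p)).image ZMod.val := by
    have hroot : ∀ x : ZMod p, (c * x + a * b) * (c * x - a * b) * ((b * x + a * c) *
        (b * x - a * c)) = 0 ↔ x ∈ ({u, -u, v, -v} : Finset (ZMod p)) := by
      intro x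
      have e1 : (c : ZMod p) * x + a * b = c * (x + u) := by rw [mul_add, huc]
      have e2 : (c : ZMod p) * x - a * b = c * (x - u) := by rw [mul_sub, huc]
      have e3 : (b : ZMod p) * x + a * c = b * (x + v) := by rw [mul_add, hvb]
      have e4 : (b : ZMod p) * x - a * c = b * (x - v) := by rw [mul_sub, hvb]
      rw [e1, e2, e3, e4]
      simp only [mul_eq_zero, hc, hb, false_or, Finset.mem_insert, Finset.mem_singleton,
        sub_eq_zero, add_eq_zero_iff_eq_neg]
      tauto
    ext x
    simp only [formRoots, Finset.mem_filter, Finset.mem_range, Finset.mem_image]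
    rw [← ZMod.intCast_zmod_eq_zero_iff_dvd, formProduct]
    push_cast
    rw [hroot]
    constructor
    · rintro ⟨hx, h⟩
      exact ⟨_, h, ZMod.val_cast_of_lt hx⟩
    · rintro ⟨y, hy, rfl⟩
      exact ⟨ZMod.val_lt y, by rwa [ZMod.natCast_zmod_val]⟩
  rw [himg, Finset.card_image_of_injective _ (ZMod.val_injective p), hcard]

theorem card_filter_natAbs_linear_lt_le (D K : ℕ) {α : ℤ} (hα : α ≠ 0) (β : ℤ) :
    ((Finset.range D).filter fun d : ℕ => (α * d + β).natAbs < K).card ≤ 2 * K := by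
  have h : ((Finset.range D).filter fun d : ℕ => (α * d + β).natAbs < K).card ≤
      (Finset.Ioo (-(K : ℤ)) K).card := by
    refine Finset.card_le_card_of_injOn (fun d : ℕ => α * d + β) (fun d hd => ?_) ?_
    · have := (Finset.mem_filter.1 hd).2
      simp only [Finset.coe_Ioo, Set.mem_Ioo]
      omega
    · intro x _ y _ hxy
      have : α * (x : ℤ) = α * y := by simpa using hxy
      exact_mod_cast mul_left_cancel₀ hα this
  refine h.trans ?_
  rw [Int.card_Ioo]
  omega

theorem IsTwicePrime.eq_two_mul_of_dvd {n p : ℕ} (hn : IsTwicePrime n) (hp : p.Prime) (hp2 : p ≠ 2)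
    (h : p ∣ n) : n = 2 * p := by
  obtain ⟨q, hq, rfl⟩ := hn
  rcases (Nat.Prime.dvd_mul hp).1 h with h | h
  · exact absurd ((Nat.prime_dvd_prime_iff_eq hp Nat.prime_two).1 h) hp2
  · rw [(Nat.prime_dvd_prime_iff_eq hp hq).1 h]

theorem exists_natAbs_lt_of_areTwicePrimes {a b c d p K : ℕ} (h : AreTwicePrimes a b c d)
    (hp : p.Prime) (hp2 : p ≠ 2) (hpK : 2 * p < K) (hd : d % p ∈ formRoots a b c p) :
    ((c : ℤ) * d + a * b).natAbs < K ∨ ((c : ℤ) * d + -(a * b)).natAbs < K ∨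
      ((b : ℤ) * d + a * c).natAbs < K ∨ ((b : ℤ) * d + -(a * c)).natAbs < K := by
  have hpp : Prime (p : ℤ) := Nat.prime_iff_prime_int.1 hp
  have h1 : (p : ℤ) ∣ formProduct a b c d := by
    have h2 := (Finset.mem_filter.1 hd).2
    have : Fact p.Prime := ⟨hp⟩
    rw [← ZMod.intCast_zmod_eq_zero_iff_dvd] at h2 ⊢
    simp only [formProduct] at h2 ⊢
    push_cast at h2 ⊢
    simpa using h2
  obtain ⟨t1, t2, t3, t4⟩ := h
  have key : ∀ n : ℤ, IsTwicePrime n.natAbs → (p : ℤ) ∣ n → n.natAbs < K := by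
    intro n hn hdvd
    rw [hn.eq_two_mul_of_dvd hp hp2 (Int.natCast_dvd.1 hdvd)]
    exact hpK
  have hnat : ∀ x y z w : ℕ, ((x : ℤ) * y + z * w).natAbs = x * y + z * w := fun x y z w => by
    exact_mod_cast Int.natAbs_natCast (x * y + z * w)
  simp only [← sub_eq_add_neg]
  simp only [formProduct] at h1
  rcases hpp.dvd_or_dvd h1 with h1 | h1 <;> rcases hpp.dvd_or_dvd h1 with h1 | h1
  · exact Or.inl (key _ ((hnat ..).symm ▸ t1) h1)
  · exact Or.inr (Or.inl (key _ t2 h1))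
  · exact Or.inr (Or.inr (Or.inl (key _ ((hnat ..).symm ▸ t3) h1)))
  · exact Or.inr (Or.inr (Or.inr (key _ t4 h1)))

theorem prod_one_add_twelve_div_le {A : Finset ℕ} {J : ℕ} (hJ : 1 ≤ J)
    (hA : A ⊆ Nat.primesBelow (2 ^ J)) :
    ∏ p ∈ A, (1 + 3 * ((4 : ℝ) / p)) ≤ Real.exp (48 + 48 * Real.log J) := by
  calc _ ≤ ∏ p ∈ A, Real.exp (12 * ((1 : ℝ) / p)) := by
        refine Finset.prod_le_prod (fun p _ => by positivity) fun p _ => ?_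
        refine le_trans (le_of_eq ?_) (Real.add_one_le_exp _)
        ring
    _ = Real.exp (12 * ∑ p ∈ A, (1 : ℝ) / p) := by rw [← Real.exp_sum, Finset.mul_sum]
    _ ≤ _ := by
        rw [Real.exp_le_exp]
        have h1 := sum_primesBelow_two_pow_inv_le_log hJ
        have h2 : ∑ p ∈ A, (1 : ℝ) / p ≤ ∑ p ∈ Nat.primesBelow (2 ^ J), (1 : ℝ) / p :=
          Finset.sum_le_sum_of_subset_of_nonneg hA fun p _ _ => by positivity
        linarith

theorem card_filter_areTwicePrimes_le_sieve {a b c I J : ℕ} (ha : 0 < a) (hb : 0 < b) (hc : 0 < c)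
    (hbc : b ≠ c) (hI : 3 ≤ I) (hJ : 1 ≤ J) {B : ℝ} (D r : ℕ)
    (hΔ : ((a * b * c * ((b : ℤ) ^ 4 - (c : ℤ) ^ 4).natAbs).primeFactors.card : ℝ) ≤ B * 2 ^ I) :
    (((Finset.range D).filter fun d => AreTwicePrimes a b c d).card : ℝ) ≤
      D * ((Real.exp (8 + 8 * Real.log I + 2 * B) / (J * Real.log 2)) ^ 4 +
        ((3 : ℝ) ^ (2 * r))⁻¹ * Real.exp (48 + 48 * Real.log J)) +
      (2 ^ ((J + 3) * (2 * r)) + 2 ^ (J + 4)) := by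
  classical
  set Δ := a * b * c * ((b : ℤ) ^ 4 - (c : ℤ) ^ 4).natAbs with hΔdef
  have hΔ0 : Δ ≠ 0 := by
    have h4 : (b : ℤ) ^ 4 - (c : ℤ) ^ 4 ≠ 0 := by
      intro h
      have h5 : b ^ 4 = c ^ 4 := by exact_mod_cast sub_eq_zero.1 h
      exact hbc (Nat.pow_left_injective (by norm_num : 4 ≠ 0) h5)
    rw [hΔdef]
    exact mul_ne_zero (by positivity) (Int.natAbs_ne_zero.2 h4)
  set P := (Nat.primesBelow (2 ^ J)).filter (fun p => 2 ^ I ≤ p ∧ p ∉ Δ.primeFactors) with hP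
  have hPprime : ∀ p ∈ P, p.Prime := fun p hp =>
    Nat.prime_of_mem_primesBelow (Finset.mem_filter.1 hp).1
  have hPtwo : ∀ p ∈ P, p ≠ 2 := by
    intro p hp h
    have h8 : 2 ^ 3 ≤ p := (Nat.pow_le_pow_right two_pos hI).trans (Finset.mem_filter.1 hp).2.1
    omega
  have hPlt : ∀ p ∈ P, p < 2 ^ J := fun p hp =>
    (Nat.mem_primesBelow.1 (Finset.mem_filter.1 hp).1).1
  have hsieve := card_filter_mod_notMem_le P hPprime (formRoots a b c) 4
    (fun p _ x hx => Finset.mem_range.1 (Finset.mem_filter.1 hx).1)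
    (fun p hp => card_formRoots (hPprime p hp) (hPtwo p hp) fun hdvd =>
      (Finset.mem_filter.1 hp).2.2 (Nat.mem_primeFactors.2 ⟨hPprime p hp, hdvd, hΔ0⟩)) D r
  set K := 2 ^ (J + 1) with hK
  have hsub : ((Finset.range D).filter fun d => AreTwicePrimes a b c d) ⊆
      ((Finset.range D).filter fun d => ∀ p ∈ P, d % p ∉ formRoots a b c p) ∪
      ((((Finset.range D).filter fun d : ℕ => ((c : ℤ) * d + a * b).natAbs < K) ∪
        ((Finset.range D).filter fun d : ℕ => ((c : ℤ) * d + -(a * b)).natAbs < K)) ∪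
      (((Finset.range D).filter fun d : ℕ => ((b : ℤ) * d + a * c).natAbs < K) ∪
        ((Finset.range D).filter fun d : ℕ => ((b : ℤ) * d + -(a * c)).natAbs < K))) := by
    intro d hd
    obtain ⟨hdD, hd⟩ := Finset.mem_filter.1 hd
    by_cases hgood : ∀ p ∈ P, d % p ∉ formRoots a b c p
    · exact Finset.mem_union_left _ (Finset.mem_filter.2 ⟨hdD, hgood⟩)
    · push Not at hgood
      obtain ⟨p, hp, hroot⟩ := hgood
      have hpK : 2 * p < K := by
        have := hPlt p hp
        rw [hK, pow_succ]; omega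
      have := exists_natAbs_lt_of_areTwicePrimes hd (hPprime p hp) (hPtwo p hp) hpK hroot
      simp only [Finset.mem_union, Finset.mem_filter, hdD, true_and]
      tauto
  have hc' : (c : ℤ) ≠ 0 := by exact_mod_cast hc.ne'
  have hb' : (b : ℤ) ≠ 0 := by exact_mod_cast hb.ne'
  have hcard := (Finset.card_le_card hsub).trans ((Finset.card_union_le _ _).trans
    (Nat.add_le_add_left ((Finset.card_union_le _ _).trans (Nat.add_le_add
      ((Finset.card_union_le _ _).trans (Nat.add_le_add
        (card_filter_natAbs_linear_lt_le D K hc' _) (card_filter_natAbs_linear_lt_le D K hc' _)))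
      ((Finset.card_union_le _ _).trans (Nat.add_le_add
        (card_filter_natAbs_linear_lt_le D K hb' _) (card_filter_natAbs_linear_lt_le D K hb' _)))))
      _))
  have hcard' : (((Finset.range D).filter fun d => AreTwicePrimes a b c d).card : ℝ) ≤
      ((Finset.range D).filter fun d => ∀ p ∈ P, d % p ∉ formRoots a b c p).card + 2 ^ (J + 4) := by
    have h8 : 2 * K + 2 * K + (2 * K + 2 * K) = 2 ^ (J + 4) := by rw [hK]; ring
    rw [h8] at hcard
    exact_mod_cast hcard
  have hV := prod_one_sub_four_div_le hI hJ hΔ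
  have hW := prod_one_add_twelve_div_le hJ (Finset.filter_subset _ _ : P ⊆ _)
  have hPcard : P.card ≤ 2 ^ J :=
    (Finset.card_filter_le _ _).trans
      ((Finset.card_filter_le _ _).trans (Finset.card_range _).le)
  have hE : (1 + ((4 : ℕ) : ℝ) * P.card) ^ (2 * r) ≤ 2 ^ ((J + 3) * (2 * r)) := by
    rw [pow_mul (2 : ℝ)]
    apply pow_le_pow_left₀
    · positivity
    have h1 : (P.card : ℝ) ≤ 2 ^ J := by exact_mod_cast hPcard
    have h2 : (1 : ℝ) ≤ 2 ^ J := one_le_pow₀ one_le_two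
    rw [pow_add]; push_cast; linarith
  push_cast at hsieve hE
  have hmain : (D : ℝ) * (∏ p ∈ P, (1 - (4 : ℝ) / p) +
      ((3 : ℝ) ^ (2 * r))⁻¹ * ∏ p ∈ P, (1 + 3 * ((4 : ℝ) / p))) ≤
      D * ((Real.exp (8 + 8 * Real.log I + 2 * B) / (J * Real.log 2)) ^ 4 +
        ((3 : ℝ) ^ (2 * r))⁻¹ * Real.exp (48 + 48 * Real.log J)) := by
    gcongr
  linarith

theorem two_pow_card_primeFactors_le {n : ℕ} (hn : n ≠ 0) : 2 ^ n.primeFactors.card ≤ n :=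
  (Finset.pow_card_le_prod _ _ _ fun _ hp => (Nat.prime_of_mem_primeFactors hp).two_le).trans
    (Nat.le_of_dvd (Nat.pos_of_ne_zero hn) (Nat.prod_primeFactors_dvd n))

theorem card_primeFactors_mul_pow_sub_pow_le {a b c ℓ : ℕ} (ha : 0 < a) (hb : 0 < b) (hc : 0 < c)
    (hbc : b ≠ c) (haℓ : a ≤ 2 ^ ℓ) (hbℓ : b ≤ 2 ^ ℓ) (hcℓ : c ≤ 2 ^ ℓ) :
    (a * b * c * ((b : ℤ) ^ 4 - (c : ℤ) ^ 4).natAbs).primeFactors.card ≤ 7 * ℓ := by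
  have h4 : (b : ℤ) ^ 4 - (c : ℤ) ^ 4 ≠ 0 := by
    intro h
    have h5 : b ^ 4 = c ^ 4 := by exact_mod_cast sub_eq_zero.1 h
    exact hbc (Nat.pow_left_injective (by norm_num : 4 ≠ 0) h5)
  have h0 : a * b * c * ((b : ℤ) ^ 4 - (c : ℤ) ^ 4).natAbs ≠ 0 :=
    mul_ne_zero (by positivity) (Int.natAbs_ne_zero.2 h4)
  have hb4 : b ^ 4 ≤ (2 ^ ℓ) ^ 4 := Nat.pow_le_pow_left hbℓ 4
  have hc4 : c ^ 4 ≤ (2 ^ ℓ) ^ 4 := Nat.pow_le_pow_left hcℓ 4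
  have hsub : ((b : ℤ) ^ 4 - (c : ℤ) ^ 4).natAbs ≤ (2 ^ ℓ) ^ 4 := by
    have hb4' : (b : ℤ) ^ 4 ≤ (2 ^ ℓ) ^ 4 := by exact_mod_cast hb4
    have hc4' : (c : ℤ) ^ 4 ≤ (2 ^ ℓ) ^ 4 := by exact_mod_cast hc4
    have hb0 : 0 ≤ (b : ℤ) ^ 4 := by positivity
    have hc0 : 0 ≤ (c : ℤ) ^ 4 := by positivity
    zify
    rw [abs_le]
    constructor <;> linarith
  refine (Nat.pow_le_pow_iff_right one_lt_two).1 ((two_pow_card_primeFactors_le h0).trans ?_)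
  calc _ ≤ 2 ^ ℓ * 2 ^ ℓ * 2 ^ ℓ * (2 ^ ℓ) ^ 4 := by gcongr
    _ = _ := by ring

theorem card_filter_areTwicePrimes_le_of_bounds {a b c I ℓ N : ℕ} (ha : 0 < a) (hb : 0 < b)
    (hc : 0 < c) (hbc : b ≠ c) (haN : a ≤ 2 * N) (hbN : b ≤ 2 * N) (hcN : c ≤ 2 * N) (hI : 3 ≤ I)
    (hℓI : ℓ < 2 ^ I) (hIℓ : I ^ 36 ≤ ℓ) (hIℓ' : 1000 * I ≤ ℓ) (hN : 2 * N < 2 ^ ℓ)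
    (hN' : 2 ^ ℓ ≤ 4 * N) {D : ℕ} (hD : N ≤ D ^ 2) :
    (((Finset.range D).filter fun d => AreTwicePrimes a b c d).card : ℝ) ≤
      (Real.exp 88 * 4000 ^ 4 + Real.exp 48 + 1) * D / (ℓ : ℝ) ^ 3 := by
  set J := ℓ / (1000 * I) with hJdef
  have hI0 : 0 < 1000 * I := by omega
  have hJ : 1 ≤ J := (Nat.one_le_div_iff hI0).2 hIℓ'
  have hJI : J * (1000 * I) ≤ ℓ := Nat.div_mul_le_self _ _
  have hJℓ : J ≤ ℓ := Nat.div_le_self _ _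
  have hℓJ : ℓ ≤ J * (2000 * I) := by
    have h := Nat.lt_div_mul_add hI0 (a := ℓ)
    rw [← hJdef] at h
    nlinarith
  have hℓ0 : 0 < ℓ := by omega
  have hΔ : ((a * b * c * ((b : ℤ) ^ 4 - (c : ℤ) ^ 4).natAbs).primeFactors.card : ℝ) ≤
      7 * 2 ^ I := by
    have h := card_primeFactors_mul_pow_sub_pow_le ha hb hc hbc (haN.trans hN.le) (hbN.trans hN.le)
      (hcN.trans hN.le)
    exact_mod_cast h.trans (Nat.mul_le_mul_left 7 hℓI.le)
  have hmain := card_filter_areTwicePrimes_le_sieve ha hb hc hbc hI hJ D (26 * I) hΔ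
  have hℓR : (0 : ℝ) < ℓ := by exact_mod_cast hℓ0
  have hJR : (0 : ℝ) < J := by exact_mod_cast hJ
  have hIR : (0 : ℝ) < I := by exact_mod_cast (by omega : 0 < I)
  have hfirst : (Real.exp (8 + 8 * Real.log I + 2 * 7) / (J * Real.log 2)) ^ 4 ≤
      Real.exp 88 * 4000 ^ 4 / (ℓ : ℝ) ^ 3 := by
    have hlog2 : (1 : ℝ) / 2 ≤ Real.log 2 := by linarith [Real.log_two_gt_d9]
    have hexp : Real.exp (8 + 8 * Real.log I + 2 * 7) = Real.exp 22 * (I : ℝ) ^ 8 := by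
      rw [show 8 + 8 * Real.log I + 2 * 7 = 22 + ((8 : ℕ) : ℝ) * Real.log I by push_cast; ring,
        Real.exp_add, Real.exp_nat_mul, Real.exp_log hIR]
    have hle : Real.exp 22 * (I : ℝ) ^ 8 / (J * Real.log 2) ≤
        Real.exp 22 * 4000 * (I : ℝ) ^ 9 / ℓ := by
      have h1 : (ℓ : ℝ) ≤ J * (2000 * I) := by exact_mod_cast hℓJ
      rw [div_le_div_iff₀ (by positivity) hℓR]
      calc Real.exp 22 * (I : ℝ) ^ 8 * ℓ ≤ Real.exp 22 * (I : ℝ) ^ 8 * (J * (2000 * I)) := by gcongr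
        _ = Real.exp 22 * 4000 * (I : ℝ) ^ 9 * (J * (1 / 2)) := by ring
        _ ≤ _ := by gcongr
    have h36 : (I : ℝ) ^ 36 ≤ ℓ := by exact_mod_cast hIℓ
    calc _ ≤ (Real.exp 22 * 4000 * (I : ℝ) ^ 9 / ℓ) ^ 4 := by
          rw [hexp]
          exact pow_le_pow_left₀ (by positivity) hle 4
      _ = Real.exp 88 * 4000 ^ 4 * (I : ℝ) ^ 36 / (ℓ : ℝ) ^ 4 := by
          rw [show (88 : ℝ) = ((4 : ℕ) : ℝ) * 22 by norm_num, Real.exp_nat_mul]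
          ring
      _ ≤ Real.exp 88 * 4000 ^ 4 * ℓ / (ℓ : ℝ) ^ 4 := by gcongr
      _ = _ := by field_simp
  have hsecond : ((3 : ℝ) ^ (2 * (26 * I)))⁻¹ * Real.exp (48 + 48 * Real.log J) ≤
      Real.exp 48 / (ℓ : ℝ) ^ 3 := by
    have hexp : Real.exp (48 + 48 * Real.log J) = Real.exp 48 * (J : ℝ) ^ 48 := by
      rw [show 48 + 48 * Real.log J = 48 + ((48 : ℕ) : ℝ) * Real.log J by push_cast; ring,
        Real.exp_add, Real.exp_nat_mul, Real.exp_log hJR]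
    have h3 : (ℓ : ℝ) ^ 52 ≤ 3 ^ (2 * (26 * I)) := by
      calc (ℓ : ℝ) ^ 52 ≤ (2 ^ I) ^ 52 := by gcongr; exact_mod_cast hℓI.le
        _ ≤ (3 ^ I) ^ 52 := by gcongr; norm_num
        _ = _ := by rw [← pow_mul]; congr 1; ring
    have h1 : (1 : ℝ) ≤ ℓ := by exact_mod_cast hℓ0
    have hJℓR : (J : ℝ) ≤ ℓ := by exact_mod_cast hJℓ
    calc _ ≤ ((ℓ : ℝ) ^ 52)⁻¹ * (Real.exp 48 * (ℓ : ℝ) ^ 48) := by rw [hexp]; gcongr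
      _ = Real.exp 48 / (ℓ : ℝ) ^ 4 := by field_simp
      _ ≤ _ := by gcongr; norm_num
  have hthird : (2 : ℝ) ^ ((J + 3) * (2 * (26 * I))) + 2 ^ (J + 4) ≤ D / (ℓ : ℝ) ^ 3 := by
    set E := (J + 3) * (2 * (26 * I)) with hE
    have hEJ : J + 4 ≤ E := by
      rw [hE]
      nlinarith
    have hEℓ : 2 * (E + 1 + I * 3) + 2 ≤ ℓ := by
      rw [hE]
      nlinarith
    have hsq : (2 ^ (E + 1 + I * 3)) ^ 2 ≤ D ^ 2 := by
      refine le_trans ?_ hD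
      have h1 : 2 ^ (2 * (E + 1 + I * 3) + 2) ≤ 2 ^ ℓ := Nat.pow_le_pow_right two_pos hEℓ
      rw [pow_add, mul_comm 2, pow_mul] at h1
      omega
    have hD' : 2 ^ (E + 1 + I * 3) ≤ D := (Nat.pow_le_pow_iff_left two_ne_zero).1 hsq
    have hD'' : (2 : ℝ) ^ (E + 1) * (2 ^ I) ^ 3 ≤ D := by
      rw [← pow_mul, ← pow_add]; exact_mod_cast hD'
    have hℓI' : (ℓ : ℝ) ≤ 2 ^ I := by exact_mod_cast hℓI.le
    rw [le_div_iff₀ (by positivity)]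
    calc ((2 : ℝ) ^ E + 2 ^ (J + 4)) * (ℓ : ℝ) ^ 3 ≤ (2 ^ E + 2 ^ E) * (2 ^ I) ^ 3 := by
          gcongr; norm_num
      _ = 2 ^ (E + 1) * (2 ^ I) ^ 3 := by ring
      _ ≤ D := hD''
  calc _ ≤ _ := hmain
    _ ≤ D * (Real.exp 88 * 4000 ^ 4 / (ℓ : ℝ) ^ 3 + Real.exp 48 / (ℓ : ℝ) ^ 3) +
        D / (ℓ : ℝ) ^ 3 := by gcongr
    _ = _ := by ring

theorem exists_card_filter_areTwicePrimes_le : ∃ C > (0 : ℝ), ∃ N₀ : ℕ, ∀ N ≥ N₀,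
    ∀ a b c D : ℕ, 0 < a → 0 < b → 0 < c → b ≠ c → a ≤ 2 * N → b ≤ 2 * N → c ≤ 2 * N →
      N ≤ D ^ 2 → (((Finset.range D).filter fun d => AreTwicePrimes a b c d).card : ℝ) ≤
        C * D / (Real.log N) ^ 3 := by
  have hev : ∀ᶠ i : ℕ in Filter.atTop, ((i + 1 : ℕ) : ℝ) ^ 36 ≤ (2 : ℝ) ^ i ∧
      1000 * ((i + 1 : ℕ) : ℝ) ≤ (2 : ℝ) ^ i := by
    have key : ∀ k : ℕ, ∀ A : ℝ, 0 < A → ∀ᶠ i : ℕ in Filter.atTop,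
        A * ((i + 1 : ℕ) : ℝ) ^ k ≤ (2 : ℝ) ^ i := by
      intro k A hA
      have h := tendsto_pow_const_div_const_pow_of_one_lt k (one_lt_two (α := ℝ))
      have h' := h.comp (Filter.tendsto_add_atTop_nat 1)
      filter_upwards [h'.eventually_le_const (show (0 : ℝ) < (2 * A)⁻¹ by positivity)] with i hi
      simp only [Function.comp_apply] at hi
      rw [div_le_iff₀ (by positivity), pow_succ (2 : ℝ)] at hi
      calc _ ≤ A * ((2 * A)⁻¹ * (2 ^ i * 2)) := by gcongr
        _ = _ := by field_simp
    filter_upwards [key 36 1 one_pos, key 1 1000 (by norm_num)] with i h1 h2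
    exact ⟨by simpa using h1, by simpa using h2⟩
  obtain ⟨i₀, hi₀⟩ := Filter.eventually_atTop.1 hev
  refine ⟨Real.exp 88 * 4000 ^ 4 + Real.exp 48 + 1, by positivity, 2 ^ 2 ^ (i₀ + 2), ?_⟩
  intro N hN a b c D ha hb hc hbc haN hbN hcN hD
  have hN0 : N ≠ 0 := by
    rintro rfl
    exact absurd hN (by simp)
  have hN1 : 1 < N := (Nat.one_lt_two_pow (by positivity)).trans_le hN
  set ℓ := Nat.log 2 N + 2 with hℓ
  set i := Nat.log 2 ℓ with hi
  have hℓi : 2 ^ (i₀ + 2) ≤ ℓ := (Nat.le_log_of_pow_le one_lt_two hN).trans (Nat.le_add_right _ _)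
  have hii : i₀ + 2 ≤ i := Nat.le_log_of_pow_le one_lt_two hℓi
  have hℓ0 : ℓ ≠ 0 := by omega
  have hiℓ : 2 ^ i ≤ ℓ := Nat.pow_log_le_self 2 hℓ0
  obtain ⟨h1, h2⟩ := hi₀ i (by omega)
  have hlow : 2 ^ Nat.log 2 N ≤ N := Nat.pow_log_le_self 2 hN0
  have hupp : N < 2 ^ (Nat.log 2 N + 1) := Nat.lt_pow_succ_log_self one_lt_two N
  have hup : 2 * N < 2 ^ ℓ := by
    rw [hℓ, pow_succ]; omega
  have hb := card_filter_areTwicePrimes_le_of_bounds (I := i + 1) (ℓ := ℓ) ha hb hc hbc haN hbN hcN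
    (by omega) (Nat.lt_pow_succ_log_self one_lt_two ℓ)
    (le_trans (by exact_mod_cast h1) hiℓ) (le_trans (by exact_mod_cast h2) hiℓ) hup
    (by rw [hℓ, pow_add]; omega) hD
  refine hb.trans ?_
  have hlog : 0 < Real.log N := Real.log_pos (by exact_mod_cast hN1)
  have hlogℓ : Real.log N ≤ ℓ := by
    have h3 : (N : ℝ) ≤ 2 ^ ℓ := by exact_mod_cast (by omega : N ≤ 2 ^ ℓ)
    have h4 := Real.log_le_log (by positivity) h3
    rw [Real.log_pow] at h4
    have h5 : Real.log 2 ≤ 1 := by linarith [Real.log_two_lt_d9]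
    nlinarith [(Nat.cast_nonneg ℓ : (0 : ℝ) ≤ ℓ)]
  gcongr

/-- The quadruples of positive integers `(a, b, c, d)` with `max a b c ≤ d` for which `cd ± ab` and
`bd ± ac` are twice primes not exceeding `N`, with trivial solutions excluded. -/
def reducedQuadruples (N : ℕ) : Finset (ℕ × ℕ × ℕ × ℕ) :=
  (Finset.range (2 * N + 1) ×ˢ Finset.range (2 * N + 1) ×ˢ Finset.range (2 * N + 1) ×ˢ
    Finset.range (2 * N + 1)).filter fun q =>
    0 < q.1 ∧ 0 < q.2.1 ∧ 0 < q.2.2.1 ∧ q.1 < q.2.2.2 ∧ q.2.1 ≠ q.2.2.1 ∧ q.2.1 ≤ q.2.2.2 ∧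
      q.2.2.1 ≤ q.2.2.2 ∧ q.2.2.1 * q.2.2.2 + q.1 * q.2.1 ≤ 2 * N ∧
      q.2.1 * q.2.2.2 + q.1 * q.2.2.1 ≤ 2 * N ∧ AreTwicePrimes q.1 q.2.1 q.2.2.1 q.2.2.2

theorem sum_inv_max_sq_le (s : ℕ) :
    ∑ p ∈ Finset.Icc 1 s ×ˢ Finset.Icc 1 s, (((max p.1 p.2 : ℕ) : ℝ) ^ 2)⁻¹ ≤
      2 * (1 + Real.log s) := by
  have key : ∑ b ∈ Finset.Icc 1 s, ∑ c ∈ Finset.Icc 1 s, (if c ≤ b then ((b : ℝ) ^ 2)⁻¹ else 0) ≤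
      1 + Real.log s := by
    have h1 := harmonic_le_one_add_log s
    rw [harmonic_eq_sum_Icc] at h1
    push_cast at h1
    refine le_trans (Finset.sum_le_sum fun b hb => ?_) h1
    have hb1 := Finset.mem_Icc.1 hb
    rw [← Finset.sum_filter, Finset.sum_const, nsmul_eq_mul]
    have h2 : ((Finset.Icc 1 s).filter fun c => c ≤ b).card ≤ b := by
      refine (Finset.card_le_card (t := Finset.Icc 1 b) fun c hc => ?_).trans (by simp)
      rw [Finset.mem_filter, Finset.mem_Icc] at hc
      exact Finset.mem_Icc.2 ⟨hc.1.1, hc.2⟩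
    have hb0 : (0 : ℝ) < b := by exact_mod_cast hb1.1
    calc _ ≤ (b : ℝ) * ((b : ℝ) ^ 2)⁻¹ := by gcongr
      _ = _ := by field_simp
  rw [Finset.sum_product]
  calc _ ≤ ∑ b ∈ Finset.Icc 1 s, ∑ c ∈ Finset.Icc 1 s,
        ((if c ≤ b then ((b : ℝ) ^ 2)⁻¹ else 0) + if b ≤ c then ((c : ℝ) ^ 2)⁻¹ else 0) := by
        refine Finset.sum_le_sum fun b _ => Finset.sum_le_sum fun c _ => ?_
        have hb0 : 0 ≤ ((b : ℝ) ^ 2)⁻¹ := by positivity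
        have hc0 : 0 ≤ ((c : ℝ) ^ 2)⁻¹ := by positivity
        rcases le_total c b with h | h
        · rw [max_eq_left h, if_pos h]
          split_ifs <;> linarith
        · rw [max_eq_right h, if_pos h]
          split_ifs <;> linarith
    _ = (∑ b ∈ Finset.Icc 1 s, ∑ c ∈ Finset.Icc 1 s, if c ≤ b then ((b : ℝ) ^ 2)⁻¹ else 0) +
        ∑ c ∈ Finset.Icc 1 s, ∑ b ∈ Finset.Icc 1 s, if b ≤ c then ((c : ℝ) ^ 2)⁻¹ else 0 := by
        simp_rw [Finset.sum_add_distrib]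
        congr 1
        exact Finset.sum_comm
    _ ≤ _ := by linarith

theorem exists_card_reducedQuadruples_le : ∃ C > (0 : ℝ), ∃ N₀ : ℕ, ∀ N ≥ N₀,
    ((reducedQuadruples N).card : ℝ) ≤ C * N ^ 2 / (Real.log N) ^ 2 := by
  obtain ⟨C, hC, N₀, hN₀⟩ := exists_card_filter_areTwicePrimes_le
  refine ⟨48 * C, by positivity, max N₀ 3, fun N hN => ?_⟩
  have hN3 : 3 ≤ N := (le_max_right _ _).trans hN
  have hNN₀ : N₀ ≤ N := (le_max_left _ _).trans hN
  have hNR : (3 : ℝ) ≤ N := by exact_mod_cast hN3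
  have hlog1 : 1 ≤ Real.log N := by
    rw [Real.le_log_iff_exp_le (by linarith)]
    linarith [Real.exp_one_lt_d9]
  set s := Nat.sqrt (2 * N) with hs
  set pairs := (Finset.Icc 1 s ×ˢ Finset.Icc 1 s).filter fun p => p.1 ≠ p.2 with hpairs
  set triples : Finset (Σ _ : ℕ × ℕ, ℕ) :=
    pairs.sigma fun p => Finset.Icc 1 (2 * N / max p.1 p.2) with htriples
  have hmaps : ∀ q ∈ reducedQuadruples N, (⟨(q.2.1, q.2.2.1), q.1⟩ : Σ _ : ℕ × ℕ, ℕ) ∈ triples ∧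
      q.2.2.2 ≤ 2 * N / max q.2.1 q.2.2.1 := by
    rintro ⟨a, b, c, d⟩ hq
    obtain ⟨_, ha, hb, hc, had, hbc, hbd, hcd, h1, h2, -⟩ := Finset.mem_filter.1 hq
    dsimp only at *
    have hd : d ≤ 2 * N / max b c := by
      rw [Nat.le_div_iff_mul_le (by positivity)]
      rcases le_total b c with h | h
      · rw [max_eq_right h]; nlinarith
      · rw [max_eq_left h]; nlinarith
    refine ⟨?_, hd⟩
    simp only [htriples, hpairs, Finset.mem_sigma, Finset.mem_filter, Finset.mem_product,
      Finset.mem_Icc, hs, Nat.le_sqrt]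
    exact ⟨⟨⟨⟨hb, by nlinarith⟩, hc, by nlinarith⟩, hbc⟩, ha, by omega⟩
  rw [Finset.card_eq_sum_card_fiberwise fun q hq => (hmaps q hq).1]
  push_cast
  rw [htriples, Finset.sum_sigma]
  have hpair : ∀ p ∈ pairs, ∑ a ∈ Finset.Icc 1 (2 * N / max p.1 p.2),
      (((reducedQuadruples N).filter fun q =>
        (⟨(q.2.1, q.2.2.1), q.1⟩ : Σ _ : ℕ × ℕ, ℕ) = ⟨p, a⟩).card : ℝ) ≤
      8 * C * N ^ 2 / (Real.log N) ^ 3 * (((max p.1 p.2 : ℕ) : ℝ) ^ 2)⁻¹ := by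
    rintro ⟨b, c⟩ hp
    simp only [hpairs, Finset.mem_filter, Finset.mem_product, Finset.mem_Icc, hs,
      Nat.le_sqrt] at hp
    obtain ⟨⟨⟨hb, hbs⟩, hc, hcs⟩, hbc⟩ := hp
    dsimp only
    set M := max b c with hM
    have hM0 : 0 < M := by positivity
    have hMM : M * M ≤ 2 * N := by
      rcases le_total b c with h | h
      · rw [hM, max_eq_right h]; exact hcs
      · rw [hM, max_eq_left h]; exact hbs
    have hMN : M ≤ 2 * N := le_trans (Nat.le_mul_self M) hMM
    set L := 2 * N / M with hL
    have hL1 : 1 ≤ L := (Nat.one_le_div_iff hM0).2 hMN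
    have hLM : L * M ≤ 2 * N := Nat.div_mul_le_self _ _
    have hLM' : 2 * N < (L + 1) * M := by
      have := Nat.lt_div_mul_add hM0 (a := 2 * N)
      rw [← hL] at this
      linarith
    have hD : N ≤ (L + 1) ^ 2 := by
      by_contra! hlt
      nlinarith
    have hfib : ∀ a ∈ Finset.Icc 1 L, (((reducedQuadruples N).filter fun q =>
        (⟨(q.2.1, q.2.2.1), q.1⟩ : Σ _ : ℕ × ℕ, ℕ) = ⟨(b, c), a⟩).card : ℝ) ≤
        C * (2 * L) / (Real.log N) ^ 3 := by
      intro a ha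
      obtain ⟨ha1, haL⟩ := Finset.mem_Icc.1 ha
      have hcard : ((reducedQuadruples N).filter fun q =>
          (⟨(q.2.1, q.2.2.1), q.1⟩ : Σ _ : ℕ × ℕ, ℕ) = ⟨(b, c), a⟩).card ≤
          ((Finset.range (L + 1)).filter fun d => AreTwicePrimes a b c d).card := by
        refine Finset.card_le_card_of_injOn (fun q => q.2.2.2) ?_ ?_
        · rintro ⟨a', b', c', d⟩ hq
          obtain ⟨hq1, hq2⟩ := Finset.mem_filter.1 hq
          simp only [Sigma.mk.injEq, Prod.mk.injEq, heq_eq_eq] at hq2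
          obtain ⟨⟨rfl, rfl⟩, rfl⟩ := hq2
          have hd := (hmaps _ hq1).2
          obtain ⟨-, -, -, -, -, -, -, -, -, -, h⟩ := Finset.mem_filter.1 hq1
          exact Finset.mem_coe.2 (Finset.mem_filter.2 ⟨Finset.mem_range.2 (Nat.lt_succ_of_le hd), h⟩)
        · rintro ⟨a₁, b₁, c₁, d₁⟩ hq₁ ⟨a₂, b₂, c₂, d₂⟩ hq₂ h
          have h₁ := (Finset.mem_filter.1 hq₁).2
          have h₂ := (Finset.mem_filter.1 hq₂).2
          simp only [Sigma.mk.injEq, Prod.mk.injEq, heq_eq_eq] at h₁ h₂ h ⊢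
          omega
      have haN : a ≤ 2 * N := haL.trans (Nat.div_le_self _ _)
      have h := hN₀ N hNN₀ a b c (L + 1) ha1 hb hc hbc haN ((le_max_left _ _).trans hMN)
        ((le_max_right _ _).trans hMN) hD
      refine (Nat.cast_le.2 hcard).trans (h.trans ?_)
      have h2L : ((L + 1 : ℕ) : ℝ) ≤ 2 * L := by exact_mod_cast (by omega : L + 1 ≤ 2 * L)
      gcongr
    refine (Finset.sum_le_sum hfib).trans ?_
    rw [Finset.sum_const, Nat.card_Icc, Nat.add_sub_cancel, nsmul_eq_mul]
    have hMR : (0 : ℝ) < M := by exact_mod_cast hM0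
    have hLR : (L : ℝ) ≤ 2 * N / M := by
      rw [le_div_iff₀ hMR]; exact_mod_cast hLM
    calc (L : ℝ) * (C * (2 * L) / (Real.log N) ^ 3) = 2 * C * (L : ℝ) ^ 2 / (Real.log N) ^ 3 := by
          ring
      _ ≤ 2 * C * (2 * N / M) ^ 2 / (Real.log N) ^ 3 := by gcongr
      _ = _ := by field_simp; ring
  refine (Finset.sum_le_sum hpair).trans ?_
  rw [← Finset.mul_sum]
  have hsum : ∑ p ∈ pairs, (((max p.1 p.2 : ℕ) : ℝ) ^ 2)⁻¹ ≤ 6 * Real.log N := by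
    have h1 : ∑ p ∈ pairs, (((max p.1 p.2 : ℕ) : ℝ) ^ 2)⁻¹ ≤ 2 * (1 + Real.log s) :=
      (Finset.sum_le_sum_of_subset_of_nonneg (Finset.filter_subset _ _)
        fun _ _ _ => by positivity).trans (sum_inv_max_sq_le s)
    have hs0 : 0 < s := Nat.sqrt_pos.2 (by omega)
    have hsN : (s : ℝ) ≤ 2 * N := by exact_mod_cast Nat.sqrt_le_self (2 * N)
    have h2 := Real.log_le_log (by exact_mod_cast hs0) hsN
    rw [Real.log_mul two_ne_zero (by linarith)] at h2
    linarith [Real.log_two_lt_d9]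
  calc _ ≤ 8 * C * N ^ 2 / (Real.log N) ^ 3 * (6 * Real.log N) := by gcongr
    _ = _ := by field_simp; ring

/-- The quadruples of primes `p₁, p₂, p₃, p₄ ≤ N` with `p₁² + p₂² = p₃² + p₄²`. -/
def primeQuadruples (N : ℕ) : Finset (ℕ × ℕ × ℕ × ℕ) :=
  (Nat.primesLE N ×ˢ Nat.primesLE N ×ˢ Nat.primesLE N ×ˢ Nat.primesLE N).filter fun q =>
    q.1 ^ 2 + q.2.1 ^ 2 = q.2.2.1 ^ 2 + q.2.2.2 ^ 2

theorem mem_primeQuadruples {N p₁ p₂ p₃ p₄ : ℕ} : (p₁, p₂, p₃, p₄) ∈ primeQuadruples N ↔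
    ((p₁ ≤ N ∧ p₁.Prime) ∧ (p₂ ≤ N ∧ p₂.Prime) ∧ (p₃ ≤ N ∧ p₃.Prime) ∧ (p₄ ≤ N ∧ p₄.Prime)) ∧
      p₁ ^ 2 + p₂ ^ 2 = p₃ ^ 2 + p₄ ^ 2 := by
  simp [primeQuadruples, Nat.mem_primesLE]

/-- The map sending `(a, b, c, d)` to `(cd + ab, |bd - ac|, |cd - ab|, bd + ac) / 2`. -/
def halfForms (q : ℕ × ℕ × ℕ × ℕ) : ℕ × ℕ × ℕ × ℕ :=
  ((q.2.2.1 * q.2.2.2 + q.1 * q.2.1) / 2,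
    ((q.2.1 : ℤ) * q.2.2.2 - q.1 * q.2.2.1).natAbs / 2,
    ((q.2.2.1 : ℤ) * q.2.2.2 - q.1 * q.2.1).natAbs / 2,
    (q.2.1 * q.2.2.2 + q.1 * q.2.2.1) / 2)

theorem mem_image_halfForms {N p₁ p₂ p₃ p₄ a b c d : ℕ} (h₁ : p₁.Prime) (h₂ : p₂.Prime)
    (h₃ : p₃.Prime) (h₄ : p₄.Prime) (hN₁ : p₁ ≤ N) (hN₄ : p₄ ≤ N)
    (e₁ : c * d + a * b = 2 * p₁) (e₂ : ((b : ℤ) * d - a * c).natAbs = 2 * p₂)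
    (e₃ : ((c : ℤ) * d - a * b).natAbs = 2 * p₃) (e₄ : b * d + a * c = 2 * p₄)
    (ha : 0 < a) (hb : 0 < b) (hc : 0 < c) (had : a < d) (hbc : b ≠ c) (hbd : b ≤ d) (hcd : c ≤ d) :
    (p₁, p₂, p₃, p₄) ∈ (reducedQuadruples N).image halfForms := by
  refine Finset.mem_image.2 ⟨(a, b, c, d), Finset.mem_filter.2 ⟨?_, ha, hb, hc, had, hbc, hbd, hcd,
    by dsimp only; omega, by dsimp only; omega, ⟨_, h₁, e₁⟩, ⟨_, h₃, e₃⟩, ⟨_, h₄, e₄⟩, ⟨_, h₂, e₂⟩⟩, ?_⟩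
  · simp only [Finset.mem_product, Finset.mem_range]
    have hd : d ≤ b * d := Nat.le_mul_of_pos_left d hb
    omega
  · simp only [halfForms, e₁, e₂, e₃, e₄, Nat.mul_div_cancel_left _ two_pos]

theorem mem_image_halfForms_of_mem_primeQuadruples {N p₁ p₂ p₃ p₄ : ℕ}
    (h : (p₁, p₂, p₃, p₄) ∈ primeQuadruples N) (h31 : p₃ < p₁) (h14 : p₁ ≠ p₄) :
    (p₁, p₂, p₃, p₄) ∈ (reducedQuadruples N).image halfForms := by
  obtain ⟨⟨⟨hN₁, h₁⟩, ⟨hN₂, h₂⟩, ⟨hN₃, h₃⟩, hN₄, h₄⟩, heq⟩ := mem_primeQuadruples.1 h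
  have h24 : p₂ < p₄ := by
    by_contra! hle
    nlinarith
  obtain ⟨x, rfl⟩ := Nat.exists_eq_add_of_lt h31
  obtain ⟨z, rfl⟩ := Nat.exists_eq_add_of_lt h24
  have hprod : (x + 1) * (2 * p₃ + x + 1) = (z + 1) * (2 * p₂ + z + 1) := by
    zify at heq ⊢
    linear_combination heq
  obtain ⟨a, b, ⟨c, hz⟩, ⟨d, hw⟩, hx⟩ := exists_dvd_and_dvd_of_dvd_mul (Dvd.intro _ hprod)
  have hab : 0 < a * b := by omega
  have ha : 0 < a := Nat.pos_of_mul_pos_right hab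
  have hb : 0 < b := Nat.pos_of_mul_pos_left hab
  have hc : 0 < c := Nat.pos_of_ne_zero fun h0 => by simp [h0] at hz
  have hd : 0 < d := Nat.pos_of_ne_zero fun h0 => by simp [h0] at hw
  have hy : 2 * p₃ + x + 1 = c * d := by
    rw [hz, hw, hx] at hprod
    exact Nat.eq_of_mul_eq_mul_left hab (by rw [hprod]; ring)
  have hp₂ := h₂.pos
  have hp₃ := h₃.pos
  have had : a < d := by
    by_contra! hda
    have h1 : d * b ≤ a * b := Nat.mul_le_mul_right b hda
    have h2 : d * c ≤ a * c := Nat.mul_le_mul_right c hda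
    have h3 : a * b < c * d := by omega
    have h4 : a * c < b * d := by omega
    have h5 : b < c := lt_of_mul_lt_mul_left (by linarith : d * b < d * c) (Nat.zero_le d)
    have h6 : c < b := lt_of_mul_lt_mul_left (by linarith : d * c < d * b) (Nat.zero_le d)
    omega
  have hbc : b ≠ c := by
    rintro rfl
    omega
  have e₁ : c * d + a * b = 2 * (p₃ + x + 1) := by omega
  have e₄ : b * d + a * c = 2 * (p₂ + z + 1) := by omega
  have e₂ : (b : ℤ) * d - a * c = 2 * p₂ := by
    have hz' : (z : ℤ) + 1 = a * c := by exact_mod_cast hz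
    have hw' : 2 * (p₂ : ℤ) + z + 1 = b * d := by exact_mod_cast hw
    linarith
  have e₃ : (c : ℤ) * d - a * b = 2 * p₃ := by
    have hx' : (x : ℤ) + 1 = a * b := by exact_mod_cast hx
    have hy' : 2 * (p₃ : ℤ) + x + 1 = c * d := by exact_mod_cast hy
    linarith
  by_cases hmax : b ≤ d ∧ c ≤ d
  · exact mem_image_halfForms h₁ h₂ h₃ h₄ hN₁ hN₄ e₁ (by omega) (by omega) e₄ ha hb hc had hbc hmax.1
      hmax.2
  rcases lt_or_gt_of_ne hbc with hlt | hlt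
  · exact mem_image_halfForms (a := b) (b := a) (c := d) (d := c) h₁ h₂ h₃ h₄ hN₁ hN₄ (by linarith)
      (by rw [← Int.natAbs_neg]; rw [show -((a : ℤ) * c - b * d) = 2 * p₂ by linarith]; omega)
      (by rw [show (d : ℤ) * c - b * a = 2 * p₃ by linarith]; omega) (by linarith) hb ha hd
      hlt had.ne (by omega) (by omega)
  · exact mem_image_halfForms (a := c) (b := d) (c := a) (d := b) h₁ h₂ h₃ h₄ hN₁ hN₄ (by linarith)
      (by rw [show (d : ℤ) * b - c * a = 2 * p₂ by linarith]; omega)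
      (by rw [← Int.natAbs_neg]; rw [show -((a : ℤ) * b - c * d) = 2 * p₃ by linarith]; omega)
      (by linarith) hc hd ha hlt had.ne' (by omega) (by omega)

theorem card_primeQuadruples_le (N : ℕ) : (primeQuadruples N).card ≤
    2 * (Nat.primesLE N).card ^ 2 + 2 * (reducedQuadruples N).card := by
  set P := Nat.primesLE N with hP
  set R := (reducedQuadruples N).image halfForms with hR
  have hsub : primeQuadruples N ⊆
      ((P ×ˢ P).image (fun p => (p.1, p.2, p.1, p.2)) ∪ (P ×ˢ P).image fun p => (p.1, p.2, p.2, p.1)) ∪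
      (R ∪ R.image fun q => (q.2.2.1, q.2.2.2, q.1, q.2.1)) := by
    rintro ⟨p₁, p₂, p₃, p₄⟩ h
    obtain ⟨⟨h₁, h₂, h₃, h₄⟩, heq⟩ := mem_primeQuadruples.1 h
    have hsq : ∀ {m n : ℕ}, m ^ 2 = n ^ 2 → m = n := fun h => Nat.pow_left_injective two_ne_zero h
    simp only [Finset.mem_union]
    by_cases h14 : p₁ = p₄
    · subst h14
      obtain rfl : p₂ = p₃ := hsq (by omega)
      exact Or.inl (Or.inr (Finset.mem_image.2 ⟨(p₁, p₂), by simp [hP, Nat.mem_primesLE, h₁, h₂], rfl⟩))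
    rcases lt_trichotomy p₁ p₃ with h13 | rfl | h31
    · refine Or.inr (Or.inr (Finset.mem_image.2 ⟨(p₃, p₄, p₁, p₂),
        mem_image_halfForms_of_mem_primeQuadruples (mem_primeQuadruples.2 ⟨⟨h₃, h₄, h₁, h₂⟩, heq.symm⟩)
          h13 ?_, rfl⟩))
      rintro rfl
      exact h14 (hsq (by omega))
    · obtain rfl : p₂ = p₄ := hsq (by omega)
      exact Or.inl (Or.inl (Finset.mem_image.2 ⟨(p₁, p₂), by simp [hP, Nat.mem_primesLE, h₁, h₂], rfl⟩))
    · exact Or.inr (Or.inl (mem_image_halfForms_of_mem_primeQuadruples h h31 h14))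
  have hPP : (P ×ˢ P).card = P.card ^ 2 := by rw [Finset.card_product, sq]
  have hRR : R.card ≤ (reducedQuadruples N).card := Finset.card_image_le
  have h1 : ((P ×ˢ P).image fun p : ℕ × ℕ => (p.1, p.2, p.1, p.2)).card ≤ P.card ^ 2 :=
    Finset.card_image_le.trans hPP.le
  have h2 : ((P ×ˢ P).image fun p : ℕ × ℕ => (p.1, p.2, p.2, p.1)).card ≤ P.card ^ 2 :=
    Finset.card_image_le.trans hPP.le
  have h3 : (R.image fun q => (q.2.2.1, q.2.2.2, q.1, q.2.1)).card ≤ (reducedQuadruples N).card :=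
    Finset.card_image_le.trans hRR
  have h4 := Finset.card_le_card hsub
  have h5 := h4.trans (Finset.card_union_le _ _)
  have h6 := Finset.card_union_le ((P ×ˢ P).image fun p : ℕ × ℕ => (p.1, p.2, p.1, p.2))
    ((P ×ˢ P).image fun p : ℕ × ℕ => (p.1, p.2, p.2, p.1))
  have h7 := Finset.card_union_le R (R.image fun q => (q.2.2.1, q.2.2.2, q.1, q.2.1))
  omega

theorem exists_card_primeQuadruples_le : ∃ C > (0 : ℝ), ∃ N₀ : ℕ, ∀ N ≥ N₀,
    ((primeQuadruples N).card : ℝ) ≤ C * N ^ 2 / (Real.log N) ^ 2 := by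
  obtain ⟨C, hC, N₁, hN₁⟩ := exists_card_reducedQuadruples_le
  have hlog4 : 0 < Real.log 4 := Real.log_pos (by norm_num)
  have hev := tendsto_natCast_atTop_atTop.eventually (Chebyshev.eventually_primeCounting_le one_pos)
  obtain ⟨N₂, hN₂⟩ := Filter.eventually_atTop.1 hev
  refine ⟨2 * (Real.log 4 + 1) ^ 2 + 2 * C, by positivity, max N₁ N₂, fun N hN => ?_⟩
  have h1 := hN₁ N ((le_max_left _ _).trans hN)
  have h2 := hN₂ N ((le_max_right _ _).trans hN)
  rw [Nat.floor_natCast, ← Nat.primesLE_card_eq_primeCounting] at h2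
  have h3 : ((primeQuadruples N).card : ℝ) ≤
      2 * ((Nat.primesLE N).card : ℝ) ^ 2 + 2 * (reducedQuadruples N).card := by
    exact_mod_cast card_primeQuadruples_le N
  calc _ ≤ 2 * ((Real.log 4 + 1) * N / Real.log N) ^ 2 + 2 * (C * N ^ 2 / (Real.log N) ^ 2) := by
        refine h3.trans ?_
        gcongr
    _ = _ := by ring

theorem exists_card_primeQuadruples_sqrt_le : ∃ C > (0 : ℝ), ∀ X ≥ (2 : ℝ),
    ((primeQuadruples ⌊√X⌋₊).card : ℝ) ≤ C * X / (Real.log X) ^ 2 := by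
  obtain ⟨C, hC, N₀, hN₀⟩ := exists_card_primeQuadruples_le
  set N₁ := max N₀ 2 with hN₁
  refine ⟨16 * C + 4 * (primeQuadruples N₁).card, by positivity, fun X hX => ?_⟩
  have hX0 : 0 ≤ X := by linarith
  have hlogX : 0 < Real.log X := Real.log_pos (by linarith)
  set N := ⌊√X⌋₊ with hN
  have hNX : (N : ℝ) ^ 2 ≤ X := by
    calc (N : ℝ) ^ 2 ≤ √X ^ 2 := by gcongr; exact Nat.floor_le (Real.sqrt_nonneg X)
      _ = X := Real.sq_sqrt hX0
  have hsplit : (16 * C + 4 * (primeQuadruples N₁).card) * X / (Real.log X) ^ 2 =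
      16 * C * X / (Real.log X) ^ 2 + 4 * (primeQuadruples N₁).card * X / (Real.log X) ^ 2 := by ring
  rw [hsplit]
  have hnn1 : 0 ≤ 16 * C * X / (Real.log X) ^ 2 := by positivity
  have hnn2 : 0 ≤ 4 * (primeQuadruples N₁).card * X / (Real.log X) ^ 2 := by positivity
  rcases le_total N₁ N with h | h
  · have hN2 : 2 ≤ N := (le_max_right _ _).trans h
    have hlogN : 0 < Real.log N := Real.log_pos (by exact_mod_cast hN2)
    have hXN : X ≤ (N : ℝ) ^ 4 := by
      have h1 : √X ≤ (N : ℝ) ^ 2 := by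
        have h2 : ((N + 1 : ℕ) : ℝ) ≤ (N : ℝ) ^ 2 := by exact_mod_cast (by nlinarith : N + 1 ≤ N ^ 2)
        have h3 := Nat.lt_floor_add_one √X
        push_cast at h2
        linarith
      calc X = √X ^ 2 := (Real.sq_sqrt hX0).symm
        _ ≤ ((N : ℝ) ^ 2) ^ 2 := by gcongr
        _ = _ := by ring
    have hlog : Real.log X ≤ 4 * Real.log N := by
      have := Real.log_le_log (by linarith) hXN
      rwa [Real.log_pow] at this
    have h1 := hN₀ N ((le_max_left _ _).trans h)
    have h2 : C * N ^ 2 / (Real.log N) ^ 2 ≤ 16 * C * X / (Real.log X) ^ 2 := by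
      rw [div_le_div_iff₀ (by positivity) (by positivity)]
      calc C * N ^ 2 * (Real.log X) ^ 2 ≤ C * X * (4 * Real.log N) ^ 2 := by gcongr
        _ = _ := by ring
    linarith
  · have hmono : (primeQuadruples N).card ≤ (primeQuadruples N₁).card := by
      refine Finset.card_le_card ?_
      rintro ⟨p₁, p₂, p₃, p₄⟩ hp
      obtain ⟨⟨⟨l₁, h₁⟩, ⟨l₂, h₂⟩, ⟨l₃, h₃⟩, l₄, h₄⟩, heq⟩ := mem_primeQuadruples.1 hp
      exact mem_primeQuadruples.2 ⟨⟨⟨l₁.trans h, h₁⟩, ⟨l₂.trans h, h₂⟩, ⟨l₃.trans h, h₃⟩,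
        l₄.trans h, h₄⟩, heq⟩
    have hlog : (Real.log X) ^ 2 ≤ 4 * X := by
      have h1 := Real.log_le_sub_one_of_pos (Real.sqrt_pos.2 (by linarith : 0 < X))
      rw [Real.log_sqrt hX0] at h1
      calc (Real.log X) ^ 2 ≤ (2 * √X) ^ 2 := by gcongr; linarith
        _ = 4 * X := by rw [mul_pow, Real.sq_sqrt hX0]; norm_num
    have hmono' : ((primeQuadruples N).card : ℝ) ≤ (primeQuadruples N₁).card := by
      exact_mod_cast hmono
    have h2 : ((primeQuadruples N₁).card : ℝ) ≤
        4 * (primeQuadruples N₁).card * X / (Real.log X) ^ 2 := by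
      rw [le_div_iff₀ (by positivity)]
      calc ((primeQuadruples N₁).card : ℝ) * (Real.log X) ^ 2 ≤ (primeQuadruples N₁).card * (4 * X) := by
            gcongr
        _ = _ := by ring
    linarith

theorem e_add (x y : ℝ) : e (x + y) = e x * e y := by
  rw [e, e, e, ← Complex.exp_add]
  push_cast
  ring_nf

theorem e_intCast (n : ℤ) : e n = 1 := by
  rw [e, Complex.exp_eq_one_iff]
  exact ⟨n, by push_cast; ring⟩

theorem conj_e (x : ℝ) : (starRingEnd ℂ) (e x) = e (-x) := by
  rw [e, e, ← Complex.exp_conj]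
  congr 1
  simp only [map_mul, Complex.conj_ofReal, Complex.conj_I, map_ofNat, Complex.ofReal_neg]
  ring

theorem continuous_e : Continuous e := by
  unfold e
  fun_prop

theorem integral_e_intCast_mul (n : ℤ) : ∫ α in (0 : ℝ)..1, e (n * α) = if n = 0 then 1 else 0 := by
  split_ifs with hn
  · simp [hn, e]
  · have hc : 2 * (Real.pi : ℂ) * Complex.I * n ≠ 0 := by
      simp [Real.pi_ne_zero, Complex.I_ne_zero, hn]
    have h : ∀ α : ℝ, e (n * α) = Complex.exp (2 * Real.pi * Complex.I * n * α) := fun α => by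
      rw [e]; push_cast; ring_nf
    have h1 := e_intCast n
    rw [e] at h1
    push_cast at h1
    simp_rw [h]
    rw [integral_exp_mul_complex hc]
    simp [h1]

theorem integral_norm_sum_e_sq {ι : Type*} (A : Finset ι) (w : ι → ℝ) (n : ι → ℤ) :
    ∫ α in (0 : ℝ)..1, ‖∑ i ∈ A, (w i : ℂ) * e (n i * α)‖ ^ 2 =
      ∑ q ∈ (A ×ˢ A).filter (fun q => n q.1 = n q.2), w q.1 * w q.2 := by
  apply Complex.ofReal_injective
  rw [← intervalIntegral.integral_ofReal]
  have h : ∀ α : ℝ, ((‖∑ i ∈ A, (w i : ℂ) * e (n i * α)‖ ^ 2 : ℝ) : ℂ) =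
      ∑ q ∈ A ×ˢ A, (w q.1 * w q.2 : ℂ) * e ((n q.1 - n q.2 : ℤ) * α) := fun α => by
    rw [Complex.ofReal_pow, ← Complex.mul_conj', map_sum, Finset.sum_mul_sum, ← Finset.sum_product']
    refine Finset.sum_congr rfl fun q _ => ?_
    rw [map_mul, Complex.conj_ofReal, conj_e, mul_mul_mul_comm, ← e_add]
    push_cast
    ring_nf
  simp_rw [h]
  have hint : ∀ q ∈ A ×ˢ A, IntervalIntegrable
      (fun α : ℝ => (w q.1 * w q.2 : ℂ) * e ((n q.1 - n q.2 : ℤ) * α)) volume 0 1 := fun q _ =>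
    Continuous.intervalIntegrable (continuous_const.mul (continuous_e.comp (by fun_prop))) _ _
  rw [intervalIntegral.integral_finsetSum hint]
  simp_rw [intervalIntegral.integral_const_mul, integral_e_intCast_mul, sub_eq_zero]
  rw [Finset.sum_filter]
  push_cast
  refine Finset.sum_congr rfl fun q _ => ?_
  split_ifs <;> simp

theorem Kf_nonneg (η α : ℝ) : 0 ≤ Kf η α := by
  unfold Kf
  split_ifs <;> positivity

theorem measurable_Kf (η : ℝ) : Measurable (Kf η) := by
  unfold Kf
  exact Measurable.ite (measurableSet_singleton 0) measurable_const (by fun_prop)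

theorem Kf_le_sq (η α : ℝ) : Kf η α ≤ η ^ 2 := by
  unfold Kf
  split_ifs with h
  · exact le_rfl
  · have hπα : Real.pi * α ≠ 0 := mul_ne_zero Real.pi_ne_zero h
    rw [div_pow, div_le_iff₀ (by positivity), ← mul_pow, sq_le_sq, mul_comm η]
    exact Real.abs_sin_le_abs

theorem Kf_le_inv_sq (η : ℝ) {α m : ℝ} (hm : 0 < m) (hmα : m ≤ |α|) : Kf η α ≤ (m ^ 2)⁻¹ := by
  have hα : α ≠ 0 := abs_pos.1 (hm.trans_le hmα)
  rw [Kf, if_neg hα, div_pow, mul_pow]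
  have h1 : Real.sin (Real.pi * α * η) ^ 2 ≤ 1 := Real.sin_sq_le_one _
  have h2 : m ^ 2 ≤ α ^ 2 := by rw [← sq_abs α]; gcongr
  have h3 : 1 ≤ Real.pi ^ 2 := one_le_pow₀ (by linarith [Real.pi_gt_three])
  rw [← one_div]
  gcongr
  nlinarith [sq_nonneg m]

theorem Kf_le_inv_sub_inv {η α m : ℝ} (hη0 : 0 < η) (hη1 : η ≤ 1) (hm : 0 ≤ m) (hmα : m ≤ |α|) :
    Kf η α ≤ 6 * ((m + η⁻¹)⁻¹ - (m + 1 + η⁻¹)⁻¹) := by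
  have ht : 1 ≤ η⁻¹ := (one_le_inv₀ hη0).2 hη1
  set t := η⁻¹ with htdef
  have hη : η = t⁻¹ := (inv_inv η).symm
  have key : ∀ s : ℝ, 1 ≤ s → m ≤ s → t ≤ s → (s ^ 2)⁻¹ ≤ 6 * ((m + t)⁻¹ - (m + 1 + t)⁻¹) := by
    intro s hs hms hts
    have h1 : 6 * ((m + t)⁻¹ - (m + 1 + t)⁻¹) = 6 / ((m + t) * (m + 1 + t)) := by
      field_simp
      ring
    rw [h1, ← one_div, div_le_div_iff₀ (by positivity) (by positivity)]
    calc 1 * ((m + t) * (m + 1 + t)) ≤ 1 * ((s + s) * (s + s + s)) := by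
          gcongr
      _ = 6 * s ^ 2 := by ring
  rcases le_total m t with h | h
  · refine (Kf_le_sq η α).trans ?_
    rw [hη, inv_pow]
    exact key t ht h le_rfl
  · exact (Kf_le_inv_sq η (by linarith) hmα).trans (key m (ht.trans h) le_rfl h)

theorem hasSum_inv_sub_inv {t : ℝ} (ht : 0 < t) :
    HasSum (fun m : ℕ => ((m : ℝ) + t)⁻¹ - ((m : ℝ) + 1 + t)⁻¹) t⁻¹ := by
  rw [hasSum_iff_tendsto_nat_of_nonneg]
  · have h : ∀ n : ℕ, ∑ m ∈ Finset.range n, (((m : ℝ) + t)⁻¹ - ((m : ℝ) + 1 + t)⁻¹) =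
        t⁻¹ - ((n : ℝ) + t)⁻¹ := fun n => by
      have := Finset.sum_range_sub' (fun m : ℕ => ((m : ℝ) + t)⁻¹) n
      push_cast at this
      simpa using this
    simp_rw [h]
    have h0 : Filter.Tendsto (fun n : ℕ => ((n : ℝ) + t)⁻¹) Filter.atTop (nhds 0) :=
      tendsto_inv_atTop_zero.comp
        (Filter.tendsto_atTop_add_const_right _ t tendsto_natCast_atTop_atTop)
    simpa using tendsto_const_nhds.sub h0
  · intro m
    have : ((m : ℝ) + 1 + t)⁻¹ ≤ ((m : ℝ) + t)⁻¹ := by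
      gcongr
      linarith
    linarith

theorem integral_mul_Kf_le {f : ℝ → ℝ} (hf : Continuous f) (hf0 : ∀ α, 0 ≤ f α)
    (hper : Function.Periodic f 1) {η : ℝ} (hη0 : 0 < η) (hη1 : η ≤ 1) :
    ∫ α, f α * Kf η α ≤ 12 * η * ∫ α in (0 : ℝ)..1, f α := by
  set g : ℕ → ℝ := fun m => 6 * (((m : ℝ) + η⁻¹)⁻¹ - ((m : ℝ) + 1 + η⁻¹)⁻¹) with hg
  have hgsum : HasSum g (6 * η) := by
    have := (hasSum_inv_sub_inv (inv_pos.2 hη0)).mul_left 6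
    rwa [inv_inv] at this
  set A : ℤ → ℝ := fun k => if 0 ≤ k then g k.toNat else g (-k - 1).toNat with hA
  have hAsum : HasSum A (6 * η + 6 * η) := by
    refine HasSum.of_nat_of_neg_add_one ?_ ?_
    · simpa [hA] using hgsum
    · convert hgsum using 2 with n
      rw [hA]
      dsimp only
      rw [if_neg (by omega)]
      congr 1
      omega
  have hA0 : ∀ k, 0 ≤ A k := by
    have hg0 : ∀ m, 0 ≤ g m := fun m =>
      (Kf_nonneg η m).trans (Kf_le_inv_sub_inv hη0 hη1 (Nat.cast_nonneg m) (le_abs_self _))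
    intro k
    simp only [hA]
    split_ifs <;> exact hg0 _
  have hKA : ∀ k : ℤ, ∀ α ∈ Set.Ioc (k : ℝ) (k + 1), Kf η α ≤ A k := by
    intro k α hα
    simp only [hA]
    split_ifs with hk
    · refine Kf_le_inv_sub_inv hη0 hη1 (Nat.cast_nonneg _) ((le_trans ?_ hα.1.le).trans (le_abs_self α))
      exact_mod_cast (Int.toNat_of_nonneg hk).le
    · refine Kf_le_inv_sub_inv hη0 hη1 (Nat.cast_nonneg _) (le_trans ?_ (neg_le_abs α))
      have h1 : (((-k - 1).toNat : ℤ) : ℝ) = ((-k - 1 : ℤ) : ℝ) := by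
        rw [Int.toNat_of_nonneg (by omega)]
      push_cast at h1
      linarith [hα.2]
  set J := ∫ α in (0 : ℝ)..1, f α with hJ
  have hJ0 : 0 ≤ J := intervalIntegral.integral_nonneg zero_le_one fun α _ => hf0 α
  have hpiece : ∀ k : ℤ, ∫⁻ α in Set.Ioc (k : ℝ) (k + 1), ENNReal.ofReal (f α) = ENNReal.ofReal J := by
    intro k
    have h1 : (k : ℝ) ≤ k + 1 := by linarith
    rw [← ofReal_integral_eq_lintegral_ofReal
      ((intervalIntegrable_iff_integrableOn_Ioc_of_le h1).1 (hf.intervalIntegrable _ _))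
      (Filter.Eventually.of_forall hf0), ← intervalIntegral.integral_of_le h1,
      hper.intervalIntegral_add_eq k 0, zero_add]
  have hlint : ∫⁻ α, ENNReal.ofReal (f α * Kf η α) ≤ ENNReal.ofReal (12 * η * J) := by
    rw [← setLIntegral_univ, ← iUnion_Ioc_intCast ℝ, lintegral_iUnion
      (fun _ => measurableSet_Ioc) (Set.pairwise_disjoint_Ioc_intCast ℝ)]
    calc _ ≤ ∑' k : ℤ, ENNReal.ofReal (A k) * ENNReal.ofReal J := by
          refine ENNReal.tsum_le_tsum fun k => ?_
          rw [← hpiece k, ← lintegral_const_mul' _ _ ENNReal.ofReal_ne_top]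
          refine setLIntegral_mono' measurableSet_Ioc fun α hα => ?_
          rw [← ENNReal.ofReal_mul (hA0 k), mul_comm]
          exact ENNReal.ofReal_le_ofReal (mul_le_mul_of_nonneg_right (hKA k α hα) (hf0 α))
      _ = ENNReal.ofReal (12 * η * J) := by
          rw [ENNReal.tsum_mul_right, ← ENNReal.ofReal_tsum_of_nonneg hA0 hAsum.summable,
            hAsum.tsum_eq, ← ENNReal.ofReal_mul (by positivity)]
          ring_nf
  rw [integral_eq_lintegral_of_nonneg_ae
    (Filter.Eventually.of_forall fun α => mul_nonneg (hf0 α) (Kf_nonneg η α))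
    (hf.measurable.mul (measurable_Kf η)).aestronglyMeasurable]
  exact ENNReal.toReal_le_of_le_ofReal (by positivity) hlint

theorem integral_norm_S_two_pow_four_le (δ : ℝ) {X : ℝ} (hX : 2 ≤ X) :
    ∫ α in (0 : ℝ)..1, ‖S 2 δ X α‖ ^ 4 ≤ (primeQuadruples ⌊√X⌋₊).card * (Real.log X) ^ 4 := by
  set P := (Finset.range (⌈X⌉₊ + 1)).filter
    (fun p : ℕ => p.Prime ∧ δ * X ≤ (p : ℝ) ^ (2 : ℝ) ∧ (p : ℝ) ^ (2 : ℝ) ≤ X) with hP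
  have hPX : ∀ p ∈ P, p.Prime ∧ p ≤ ⌊√X⌋₊ := by
    intro p hp
    obtain ⟨-, hp, -, hpX⟩ := Finset.mem_filter.1 hp
    rw [Real.rpow_two] at hpX
    exact ⟨hp, Nat.le_floor (Real.le_sqrt_of_sq_le hpX)⟩
  have hlog : ∀ p ∈ P, Real.log p ≤ Real.log X := by
    intro p hp
    obtain ⟨hp, hpX⟩ := hPX p hp
    have h1 : (p : ℝ) ≤ √X := (Nat.le_floor_iff (Real.sqrt_nonneg X)).1 hpX
    exact Real.log_le_log (by exact_mod_cast hp.pos)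
      (h1.trans (Real.sqrt_le_iff.2 ⟨by linarith, by nlinarith⟩))
  have hlogX : 0 ≤ Real.log X := Real.log_nonneg (by linarith)
  have hS : ∀ α : ℝ, ‖S 2 δ X α‖ ^ 4 = ‖∑ q ∈ P ×ˢ P, ((Real.log q.1 * Real.log q.2 : ℝ) : ℂ) *
      e ((((q.1 ^ 2 + q.2 ^ 2 : ℕ) : ℤ) : ℝ) * α)‖ ^ 2 := by
    intro α
    rw [show ‖S 2 δ X α‖ ^ 4 = ‖S 2 δ X α * S 2 δ X α‖ ^ 2 by rw [norm_mul]; ring]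
    congr 2
    rw [S, Finset.sum_mul_sum, ← Finset.sum_product']
    refine Finset.sum_congr rfl fun q _ => ?_
    rw [mul_mul_mul_comm, ← e_add, Real.rpow_two, Real.rpow_two]
    push_cast
    ring_nf
  simp_rw [hS]
  rw [integral_norm_sum_e_sq (P ×ˢ P) (fun q => Real.log q.1 * Real.log q.2)
    (fun q => ((q.1 ^ 2 + q.2 ^ 2 : ℕ) : ℤ))]
  set Q := ((P ×ˢ P) ×ˢ (P ×ˢ P)).filter
    (fun q => ((q.1.1 ^ 2 + q.1.2 ^ 2 : ℕ) : ℤ) = ((q.2.1 ^ 2 + q.2.2 ^ 2 : ℕ) : ℤ)) with hQ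
  have hcard : Q.card ≤ (primeQuadruples ⌊√X⌋₊).card := by
    refine Finset.card_le_card_of_injOn (fun q => (q.1.1, q.1.2, q.2.1, q.2.2)) ?_ ?_
    · rintro ⟨⟨p₁, p₂⟩, p₃, p₄⟩ hq
      obtain ⟨hq, heq⟩ := Finset.mem_filter.1 hq
      simp only [Finset.mem_product] at hq
      exact Finset.mem_coe.2 (mem_primeQuadruples.2 ⟨⟨(hPX _ hq.1.1).symm, (hPX _ hq.1.2).symm,
        (hPX _ hq.2.1).symm, (hPX _ hq.2.2).symm⟩, by exact_mod_cast heq⟩)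
    · rintro ⟨⟨p₁, p₂⟩, p₃, p₄⟩ - ⟨⟨q₁, q₂⟩, q₃, q₄⟩ - h
      simp only [Prod.mk.injEq] at h ⊢
      tauto
  calc _ ≤ ∑ q ∈ Q, (Real.log X * Real.log X) * (Real.log X * Real.log X) := by
        refine Finset.sum_le_sum fun q hq => ?_
        have hq := (Finset.mem_filter.1 hq).1
        simp only [Finset.mem_product] at hq
        have h1 := hlog _ hq.1.1
        have h2 := hlog _ hq.1.2
        have h3 := hlog _ hq.2.1
        have h4 := hlog _ hq.2.2
        have h0 : ∀ n : ℕ, 0 ≤ Real.log n := Real.log_natCast_nonneg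
        have := h0 q.1.1
        have := h0 q.1.2
        have := h0 q.2.1
        have := h0 q.2.2
        gcongr
    _ = Q.card * (Real.log X) ^ 4 := by
        rw [Finset.sum_const, nsmul_eq_mul]
        ring
    _ ≤ _ := by gcongr

theorem continuous_S_two (δ X : ℝ) : Continuous (S 2 δ X) := by
  unfold S
  exact continuous_finsetSum _ fun p _ =>
    continuous_const.mul (continuous_e.comp (continuous_const.mul continuous_id))

theorem periodic_S_two (δ X : ℝ) : Function.Periodic (S 2 δ X) 1 := by
  intro α
  unfold S
  refine Finset.sum_congr rfl fun p _ => ?_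
  have h : e ((p : ℝ) ^ (2 : ℝ)) = 1 := by
    have h1 := e_intCast ((p : ℤ) ^ 2)
    push_cast at h1
    rwa [Real.rpow_two]
  rw [mul_add, mul_one, e_add, h, mul_one]

theorem statement7 (δ : ℝ) (hδ0 : 0 < δ) (hδ1 : δ < 1) :
    ∃ C > 0, ∀ X ≥ (2 : ℝ), ∀ η : ℝ, 0 < η → η ≤ 1 →
      (∫ α : ℝ, ‖S 2 δ X α‖ ^ 4 * Kf η α) ≤ C * η * X * (Real.log X) ^ 2 := by
  obtain ⟨C, hC, hcount⟩ := exists_card_primeQuadruples_sqrt_le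
  refine ⟨12 * C, by positivity, fun X hX η hη0 hη1 => ?_⟩
  have hlogX : 0 < Real.log X := Real.log_pos (by linarith)
  calc (∫ α : ℝ, ‖S 2 δ X α‖ ^ 4 * Kf η α)
      ≤ 12 * η * ∫ α in (0 : ℝ)..1, ‖S 2 δ X α‖ ^ 4 :=
        integral_mul_Kf_le (f := fun α => ‖S 2 δ X α‖ ^ 4) ((continuous_S_two δ X).norm.pow 4)
          (fun α => by positivity) (fun α => by dsimp only; rw [periodic_S_two δ X α]) hη0 hη1
    _ ≤ 12 * η * (C * X / (Real.log X) ^ 2 * (Real.log X) ^ 4) := by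
        have h1 := integral_norm_S_two_pow_four_le δ hX
        have h2 := hcount X hX
        gcongr
        exact h1.trans (by gcongr)
    _ = 12 * C * η * X * (Real.log X) ^ 2 := by field_simp

end
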